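/- Let n be even. Then G is the least generating set of IF_n: ⟨G⟩ = IF_n, and every subset A ⊆ IF_n with ⟨A⟩ = IF_n satisfies G ⊆ A. -/

import Mathlib

/-!
Common framework: partial injections on `X_n = {1, …, n}`, the fence order,
fence-preserving partial injections, the semigroups `PFI_n`, `IF_n`,
the set `J` of elements of rank at least `n - 2`, and (for even `n`)
the generating system `G`.
-/

namespace FencePaper

/-- The fence (zigzag) order on `{1, …, n}`: `a <_f b` iff `|a - b| = 1` and `b` is even. -/
def fenceLt (a b : ℕ) : Prop := (a + 1 = b ∨ b + 1 = a) ∧ Even b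

/-- A partial injection of `X_n = {1, …, n}`, given by its graph. -/
structure PartialInj (n : ℕ) where
  graph : Set (ℕ × ℕ)
  mem_le : ∀ p ∈ graph, 1 ≤ p.1 ∧ p.1 ≤ n ∧ 1 ≤ p.2 ∧ p.2 ≤ n
  functional : ∀ p ∈ graph, ∀ q ∈ graph, p.1 = q.1 → p.2 = q.2
  injOn : ∀ p ∈ graph, ∀ q ∈ graph, p.2 = q.2 → p.1 = q.1

namespace PartialInj

variable {n : ℕ}

theorem ext' {α β : PartialInj n} (h : α.graph = β.graph) : α = β := by
  cases α
  cases β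
  simp only at h
  subst h
  rfl

/-- The domain of a partial injection. -/
def dom (α : PartialInj n) : Set ℕ := {x | ∃ y, (x, y) ∈ α.graph}

/-- The image (range) of a partial injection. -/
def im (α : PartialInj n) : Set ℕ := {y | ∃ x, (x, y) ∈ α.graph}

/-- The rank of a partial injection: the cardinality of its image. -/
noncomputable def rank (α : PartialInj n) : ℕ := α.im.ncard

/-- The inverse partial injection. -/
def inv (α : PartialInj n) : PartialInj n where
  graph := {p | (p.2, p.1) ∈ α.graph}
  mem_le := by
    rintro p hp
    obtain ⟨h1, h2, h3, h4⟩ := α.mem_le _ hp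
    exact ⟨h3, h4, h1, h2⟩
  functional := by
    rintro p hp q hq h
    exact α.injOn _ hp _ hq h
  injOn := by
    rintro p hp q hq h
    exact α.functional _ hp _ hq h

/-- Composition: first `α`, then `β` (maps act on the right). -/
def comp (α β : PartialInj n) : PartialInj n where
  graph := {p | ∃ y, (p.1, y) ∈ α.graph ∧ (y, p.2) ∈ β.graph}
  mem_le := by
    rintro p ⟨y, h1, h2⟩
    obtain ⟨a, b, -, -⟩ := α.mem_le _ h1
    obtain ⟨-, -, c, d⟩ := β.mem_le _ h2
    exact ⟨a, b, c, d⟩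
  functional := by
    rintro p ⟨y, h1, h2⟩ q ⟨z, h3, h4⟩ h
    have hyz : y = z := α.functional _ h1 _ h3 h
    subst hyz
    exact β.functional (y, p.2) h2 (y, q.2) h4 rfl
  injOn := by
    rintro p ⟨y, h1, h2⟩ q ⟨z, h3, h4⟩ h
    have hyz : y = z := β.injOn _ h2 _ h4 h
    subst hyz
    exact α.injOn (p.1, y) h1 (q.1, y) h3 rfl

/-- The partial identity map on `D ∩ {1, …, n}`. -/
def pid (n : ℕ) (D : Set ℕ) : PartialInj n where
  graph := {p | p.1 ∈ Set.Icc 1 n ∧ p.1 ∈ D ∧ p.2 = p.1}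
  mem_le := by
    rintro p ⟨⟨h1, h2⟩, -, h3⟩
    refine ⟨h1, h2, ?_, ?_⟩ <;> omega
  functional := by
    rintro p ⟨-, -, h1⟩ q ⟨-, -, h2⟩ h
    rw [h1, h2, h]
  injOn := by
    rintro p ⟨-, -, h1⟩ q ⟨-, -, h2⟩ h
    rw [← h1, ← h2, h]

instance : Monoid (PartialInj n) where
  mul := comp
  one := pid n (Set.Icc 1 n)
  mul_assoc a b c := by
    apply ext'
    ext q
    constructor
    · rintro ⟨y, ⟨z, h1, h2⟩, h3⟩
      exact ⟨z, h1, y, h2, h3⟩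
    · rintro ⟨z, h1, y, h2, h3⟩
      exact ⟨y, ⟨z, h1, h2⟩, h3⟩
  one_mul a := by
    apply ext'
    ext q
    constructor
    · rintro ⟨y, ⟨-, -, h⟩, h2⟩
      have hy : y = q.1 := h
      rw [hy] at h2
      exact h2
    · intro hq
      obtain ⟨h1, h2, -, -⟩ := a.mem_le _ hq
      exact ⟨q.1, ⟨⟨h1, h2⟩, ⟨h1, h2⟩, rfl⟩, hq⟩
  mul_one a := by
    apply ext'
    ext q
    constructor
    · rintro ⟨y, h1, ⟨-, -, h⟩⟩
      have hy : q.2 = y := h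
      rw [← hy] at h1
      exact h1
    · intro hq
      obtain ⟨-, -, h3, h4⟩ := a.mem_le _ hq
      exact ⟨q.2, hq, ⟨h3, h4⟩, ⟨h3, h4⟩, rfl⟩

theorem mul_graph (α β : PartialInj n) :
    (α * β).graph = {p | ∃ y, (p.1, y) ∈ α.graph ∧ (y, p.2) ∈ β.graph} := rfl

/-- `α` is fence-preserving. -/
def FP (α : PartialInj n) : Prop :=
  ∀ p ∈ α.graph, ∀ q ∈ α.graph, fenceLt p.1 q.1 → fenceLt p.2 q.2

/-- The image of a subset under a partial injection. -/
def imageOf (α : PartialInj n) (S : Set ℕ) : Set ℕ := {y | ∃ x ∈ S, (x, y) ∈ α.graph}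

end PartialInj

open PartialInj

/-- `PFI_n`: the semigroup of all fence-preserving partial injections. -/
def PFIset (n : ℕ) : Set (PartialInj n) := {α | α.FP}

/-- `IF_n = {α ∈ PFI_n : α⁻¹ ∈ PFI_n}`. -/
def IFset (n : ℕ) : Set (PartialInj n) := {α | α.FP ∧ α.inv.FP}

/-- `J = {α ∈ IF_n : rank α ≥ n - 2}`. -/
def Jset (n : ℕ) : Set (PartialInj n) := {α | α ∈ IFset n ∧ n - 2 ≤ α.rank}

/-- `A` is a maximal block of consecutive integers of `D ⊆ {1, …, n}`. -/
def IsBlock (n : ℕ) (D A : Set ℕ) : Prop :=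
  ∃ i r : ℕ, 1 ≤ i ∧ A = Set.Icc i (i + r) ∧ A ⊆ D ∧
    (i = 1 ∨ i - 1 ∉ D) ∧ (i + r = n ∨ i + r + 1 ∉ D)

/-- `α(k)`: the maximal blocks of `dom α` of cardinality `k`. -/
def blockSet {n : ℕ} (α : PartialInj n) (k : ℕ) : Set (Set ℕ) :=
  {A | IsBlock n α.dom A ∧ A.ncard = k}

/-- `α°(2k+1)`: the maximal blocks `{i, …, i+2k}` of `dom α` with `i` odd. -/
def oddBlockSet {n : ℕ} (α : PartialInj n) (k : ℕ) : Set (Set ℕ) :=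
  {A | A ∈ blockSet α (2 * k + 1) ∧ Odd (sInf A)}

/-- The graph of `σ₁`: domain `X_n ∖ {2}`, `1 ↦ n`, `x ↦ x - 2` for `3 ≤ x ≤ n`. -/
def sigma1Graph (n : ℕ) : Set (ℕ × ℕ) :=
  {q | 1 ≤ q.1 ∧ q.1 ≤ n ∧ q.1 ≠ 2 ∧ q.2 = if q.1 = 1 then n else q.1 - 2}

/-- The graph of `σ₂ = σ₁⁻¹`: domain `X_n ∖ {n-1}`, `x ↦ x + 2` for `x ≤ n - 2`, `n ↦ 1`. -/
def sigma2Graph (n : ℕ) : Set (ℕ × ℕ) :=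
  {q | 1 ≤ q.1 ∧ q.1 ≤ n ∧ q.1 ≠ n - 1 ∧ q.2 = if q.1 = n then 1 else q.1 + 2}

/-- The graph of `γ_i`: domain `X_n ∖ {i}`, `x ↦ i - x` for `x < i`, `x ↦ x` for `x > i`. -/
def gammaGraph (n i : ℕ) : Set (ℕ × ℕ) :=
  {q | 1 ≤ q.1 ∧ q.1 ≤ n ∧ q.1 ≠ i ∧ q.2 = if q.1 < i then i - q.1 else q.1}

/-- The graph of `δ_i`: domain `X_n ∖ {i}`, `x ↦ x` for `x < i`, `x ↦ n + i + 1 - x` for `x > i`. -/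
def deltaGraph (n i : ℕ) : Set (ℕ × ℕ) :=
  {q | 1 ≤ q.1 ∧ q.1 ≤ n ∧ q.1 ≠ i ∧ q.2 = if q.1 < i then q.1 else n + i + 1 - q.1}

/-- The graph of `β_{i,j}`: domain `X_n ∖ {i, j}`, reversing the interval strictly
between `i` and `j` and fixing everything else. -/
def betaGraph (n i j : ℕ) : Set (ℕ × ℕ) :=
  {q | 1 ≤ q.1 ∧ q.1 ≤ n ∧ q.1 ≠ i ∧ q.1 ≠ j ∧
    q.2 = if i < q.1 ∧ q.1 < j then i + j - q.1 else q.1}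

/-- The generating system `G` (for even `n`), given elements `σ₁, σ₂` and families
`γ, δ` realizing the prescribed graphs. -/
def Gset (n : ℕ) (σ₁ σ₂ : PartialInj n) (γ δ : ℕ → PartialInj n) : Set (PartialInj n) :=
  {pid n (Set.Icc 1 n), σ₁, σ₂} ∪
    {g | ∃ i, Even i ∧ 4 ≤ i ∧ i ≤ n ∧ g = γ i} ∪
    {g | ∃ i, Odd i ∧ i ≤ n - 3 ∧ g = δ i}

section Basic

variable {n : ℕ} {α β : PartialInj n}

theorem mul_mem_IFset (hα : α ∈ IFset n) (hβ : β ∈ IFset n) : α * β ∈ IFset n := by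
  constructor
  · rintro ⟨x, z⟩ ⟨y, h1, h2⟩ ⟨x', z'⟩ ⟨y', h3, h4⟩ h
    exact hβ.1 (y, z) h2 (y', z') h4 (hα.1 (x, y) h1 (x', y') h3 h)
  · rintro ⟨z, x⟩ ⟨y, h1, h2⟩ ⟨z', x'⟩ ⟨y', h3, h4⟩ h
    exact hα.2 (y, x) h1 (y', x') h3 (hβ.2 (z, y) h2 (z', y') h4 h)

theorem pid_mem_IFset (n : ℕ) (D : Set ℕ) : pid n D ∈ IFset n := by
  constructor
  · rintro ⟨x, y⟩ ⟨-, -, h⟩ ⟨x', y'⟩ ⟨-, -, h'⟩ hf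
    simp only at h h' hf ⊢
    rwa [h, h']
  · rintro ⟨x, y⟩ ⟨-, -, h⟩ ⟨x', y'⟩ ⟨-, -, h'⟩ hf
    simp only at h h' hf ⊢
    rwa [← h, ← h']

/-- The elements of `IF_n` preserve and reflect the fence order. -/
theorem fenceLt_iff (hα : α ∈ IFset n) {x y x' y' : ℕ} (h : (x, y) ∈ α.graph)
    (h' : (x', y') ∈ α.graph) : fenceLt x x' ↔ fenceLt y y' :=
  ⟨fun hf => hα.1 _ h _ h' hf, fun hf => hα.2 (y, x) h (y', x') h' hf⟩

theorem adj_iff_fenceLt_or (x y : ℕ) :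
    (x + 1 = y ∨ y + 1 = x) ↔ fenceLt x y ∨ fenceLt y x := by
  simp only [fenceLt, Nat.even_iff]
  omega

/-- The elements of `IF_n` preserve and reflect adjacency. -/
theorem adj_iff (hα : α ∈ IFset n) {x y x' y' : ℕ} (h : (x, y) ∈ α.graph)
    (h' : (x', y') ∈ α.graph) : (x + 1 = x' ∨ x' + 1 = x) ↔ (y + 1 = y' ∨ y' + 1 = y) := by
  rw [adj_iff_fenceLt_or, adj_iff_fenceLt_or, fenceLt_iff hα h h', fenceLt_iff hα h' h]

/-- The elements of `IF_n` preserve the parity of points that have a neighbour in the domain. -/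
theorem mod_two_eq (hα : α ∈ IFset n) {x y x' y' : ℕ} (h : (x, y) ∈ α.graph)
    (h' : (x', y') ∈ α.graph) (hx : x + 1 = x' ∨ x' + 1 = x) : x % 2 = y % 2 := by
  have h1 := fenceLt_iff hα h h'
  have h2 := fenceLt_iff hα h' h
  have h3 := (adj_iff hα h h').1 hx
  simp only [fenceLt, Nat.even_iff] at h1 h2
  omega

theorem inv_mem_IFset (hα : α ∈ IFset n) : α.inv ∈ IFset n := ⟨hα.2, hα.1⟩

/-- An element of `IF_n` maps an interval of its domain by a translation or by a reflection. -/
theorem interval_image (hα : α ∈ IFset n) (hn : 0 < n) (p k : ℕ)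
    (hdom : ∀ j < k, ∃ y, (p + j, y) ∈ α.graph) :
    ∃ s, 1 ≤ s ∧ s + k ≤ n + 1 ∧
      ((∀ j < k, (p + j, s + j) ∈ α.graph) ∨ (∀ j < k, (p + j, s + (k - 1 - j)) ∈ α.graph)) := by
  induction k with
  | zero => exact ⟨1, le_rfl, by omega, Or.inl fun j hj => absurd hj (by omega)⟩
  | succ k ih =>
    obtain ⟨s, hs1, hs2, hs⟩ := ih fun j hj => hdom j (by omega)
    obtain ⟨y, hy⟩ := hdom k (by omega)
    obtain ⟨-, -, hy1, hy2⟩ := α.mem_le _ hy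
    simp only at hy1 hy2
    rcases Nat.eq_zero_or_pos k with rfl | hk
    · refine ⟨y, hy1, by omega, Or.inl fun j hj => ?_⟩
      obtain rfl : j = 0 := by omega
      exact hy
    -- a neighbour of the previous value which differs from the value before that
    have key : ∀ v, (p + (k - 1), v) ∈ α.graph → y = v + 1 ∨ y + 1 = v := fun v hv => by
      have := (adj_iff hα hv hy).1 (Or.inl (by omega))
      omega
    have key2 : ∀ v, 2 ≤ k → (p + (k - 2), v) ∈ α.graph → y ≠ v := fun v h2 hv hyv => by
      have := α.injOn _ hv _ hy hyv.symm
      simp only at this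
      omega
    rcases hs with hs | hs
    · have h1 := key _ (hs (k - 1) (by omega))
      by_cases hyk : y = s + k
      · refine ⟨s, hs1, by omega, Or.inl fun j hj => ?_⟩
        rcases Nat.lt_succ_iff_lt_or_eq.1 hj with h | rfl
        · exact hs j h
        · rwa [← hyk]
      · have hk1 : k = 1 := by
          by_contra hne
          have := key2 _ (by omega) (hs (k - 2) (by omega))
          omega
        subst hk1
        refine ⟨y, hy1, by omega, Or.inr fun j hj => ?_⟩
        obtain rfl | rfl : j = 0 ∨ j = 1 := by omega
        · have h0 := hs 0 (by omega)
          rwa [show y + (1 + 1 - 1 - 0) = s + 0 by omega]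
        · exact hy
    · have h1 := key _ (hs (k - 1) (by omega))
      by_cases hyk : y + 1 = s
      · refine ⟨y, hy1, by omega, Or.inr fun j hj => ?_⟩
        rcases Nat.lt_succ_iff_lt_or_eq.1 hj with h | rfl
        · have := hs j h
          rwa [show y + (k + 1 - 1 - j) = s + (k - 1 - j) by omega]
        · rwa [show y + (j + 1 - 1 - j) = y by omega]
      · have hk1 : k = 1 := by
          by_contra hne
          have := key2 _ (by omega) (hs (k - 2) (by omega))
          omega
        subst hk1
        refine ⟨s, hs1, by omega, Or.inl fun j hj => ?_⟩
        obtain rfl | rfl : j = 0 ∨ j = 1 := by omega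
        · exact hs 0 (by omega)
        · rwa [show s + 1 = y by omega]

end Basic

section Irreducible

variable {n : ℕ} {α : PartialInj n}

theorem eq_of_full_dom (hn : Even n) (hn0 : 0 < n) (hα : α ∈ IFset n)
    (hdom : ∀ x, 1 ≤ x → x ≤ n → x ∈ α.dom) {x y : ℕ} (hxy : (x, y) ∈ α.graph) : y = x := by
  rw [Nat.even_iff] at hn
  obtain ⟨s, hs1, hs2, hs⟩ := interval_image hα hn0 1 n
    fun j hj => hdom (1 + j) (by omega) (by omega)
  obtain ⟨hx1, hx2, -, -⟩ := α.mem_le _ hxy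
  simp only at hx1 hx2
  obtain ⟨j, rfl⟩ := Nat.exists_eq_add_of_le hx1
  rcases hs with hs | hs
  · have := α.functional _ hxy _ (hs j (by omega)) rfl
    simp only at this
    omega
  · have := mod_two_eq hα (hs 0 (by omega)) (hs 1 (by omega)) (Or.inl rfl)
    omega

theorem eq_one_of_full_dom (hn : Even n) (hn0 : 0 < n) (hα : α ∈ IFset n)
    (hdom : ∀ x, 1 ≤ x → x ≤ n → x ∈ α.dom) : α = 1 := by
  apply ext'
  ext ⟨x, y⟩
  constructor
  · intro h
    obtain ⟨h1, h2, -, -⟩ := α.mem_le _ h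
    exact ⟨⟨h1, h2⟩, ⟨h1, h2⟩, eq_of_full_dom hn hn0 hα hdom h⟩
  · rintro ⟨⟨h1, h2⟩, -, h3⟩
    simp only at h1 h2 h3
    obtain ⟨z, hz⟩ := hdom x h1 h2
    have := eq_of_full_dom hn hn0 hα hdom hz
    rw [this] at hz
    rwa [h3]

/-- A partial injection whose domain is `X_n ∖ {i}` is determined by an equation for its values. -/
theorem graph_eq_of_dom {i : ℕ} (hi : i ∉ α.dom)
    (hdom : ∀ x, 1 ≤ x → x ≤ n → x ≠ i → x ∈ α.dom) {f : ℕ → ℕ}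
    (hf : ∀ x y, (x, y) ∈ α.graph → y = f x) :
    α.graph = {q | 1 ≤ q.1 ∧ q.1 ≤ n ∧ q.1 ≠ i ∧ q.2 = f q.1} := by
  ext ⟨x, y⟩
  constructor
  · intro h
    obtain ⟨h1, h2, -, -⟩ := α.mem_le _ h
    exact ⟨h1, h2, fun hx => hi ⟨y, hx ▸ h⟩, hf x y h⟩
  · rintro ⟨h1, h2, h3, h4⟩
    simp only at h1 h2 h3 h4
    obtain ⟨z, hz⟩ := hdom x h1 h2 h3
    rw [h4, ← hf x z hz]
    exact hz

/-- The elements of `IF_n` whose domain is `X_n ∖ {i}`. -/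
theorem graph_eq_generator_of_dom (hn : Even n) (hn0 : 0 < n) (hα : α ∈ IFset n)
    {i : ℕ} (hi1 : 1 ≤ i) (hin : i ≤ n) (hi : i ∉ α.dom)
    (hdom : ∀ x, 1 ≤ x → x ≤ n → x ≠ i → x ∈ α.dom) :
    (∀ x y, (x, y) ∈ α.graph → y = x) ∨
    (Even i ∧ α.graph = gammaGraph n i) ∨ (Odd i ∧ α.graph = deltaGraph n i) ∨
    (i = 2 ∧ α.graph = sigma1Graph n) ∨ (i = n - 1 ∧ α.graph = sigma2Graph n) := by
  rw [Nat.even_iff] at hn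
  have hxle : ∀ x y, (x, y) ∈ α.graph → 1 ≤ x ∧ x ≤ n ∧ x ≠ i := fun x y h =>
    ⟨(α.mem_le _ h).1, (α.mem_le _ h).2.1, fun hx => hi ⟨y, hx ▸ h⟩⟩
  obtain ⟨s, hs1, hs2, hs⟩ := interval_image hα hn0 1 (i - 1)
    fun j hj => hdom (1 + j) (by omega) (by omega) (by omega)
  obtain ⟨t, ht1, ht2, ht⟩ := interval_image hα hn0 (i + 1) (n - i)
    fun j hj => hdom (i + 1 + j) (by omega) (by omega) (by omega)
  have hs' : ∀ y, s ≤ y → y < s + (i - 1) → ∃ x, x < i ∧ (x, y) ∈ α.graph := by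
    intro y h1 h2
    rcases hs with hs | hs
    · refine ⟨1 + (y - s), by omega, ?_⟩
      have := hs (y - s) (by omega)
      rwa [show s + (y - s) = y by omega] at this
    · refine ⟨1 + (s + (i - 1) - 1 - y), by omega, ?_⟩
      have := hs (s + (i - 1) - 1 - y) (by omega)
      rwa [show s + (i - 1 - 1 - (s + (i - 1) - 1 - y)) = y by omega] at this
  have ht' : ∀ y, t ≤ y → y < t + (n - i) → ∃ x, i < x ∧ (x, y) ∈ α.graph := by
    intro y h1 h2
    rcases ht with ht | ht
    · refine ⟨i + 1 + (y - t), by omega, ?_⟩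
      have := ht (y - t) (by omega)
      rwa [show t + (y - t) = y by omega] at this
    · refine ⟨i + 1 + (t + (n - i) - 1 - y), by omega, ?_⟩
      have := ht (t + (n - i) - 1 - y) (by omega)
      rwa [show t + (n - i - 1 - (t + (n - i) - 1 - y)) = y by omega] at this
  have hsep : ∀ y y', s ≤ y → y < s + (i - 1) → t ≤ y' → y' < t + (n - i) →
      y ≠ y' ∧ y + 1 ≠ y' ∧ y' + 1 ≠ y := by
    intro y y' h1 h2 h3 h4
    obtain ⟨x, hx, hxy⟩ := hs' y h1 h2
    obtain ⟨x', hx', hxy'⟩ := ht' y' h3 h4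
    have h5 := adj_iff hα hxy hxy'
    refine ⟨fun h => ?_, by omega, by omega⟩
    have := α.injOn _ hxy _ hxy' h
    simp only at this
    omega
  have horder : i = 1 ∨ i = n ∨ s + i ≤ t ∨ t + (n - i) + 1 ≤ s := by
    by_contra! h
    rcases le_total s t with hst | hst
    · have := hsep (min t (s + (i - 1) - 1)) t (by omega) (by omega) (by omega) (by omega)
      omega
    · have := hsep s (min s (t + (n - i) - 1)) (by omega) (by omega) (by omega) (by omega)
      omega
  have hA : ((∀ x y, (x, y) ∈ α.graph → x < i → y + 1 = s + x) ∧ (3 ≤ i → s % 2 = 1)) ∨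
      ((∀ x y, (x, y) ∈ α.graph → x < i → y + x + 1 = s + i) ∧ (3 ≤ i → (s + i) % 2 = 1)) := by
    rcases hs with hs | hs
    · refine Or.inl ⟨fun x y hxy hx => ?_, fun h3 => ?_⟩
      · obtain ⟨j, rfl⟩ := Nat.exists_eq_add_of_le (hxle x y hxy).1
        have := α.functional _ hxy _ (hs j (by omega)) rfl
        simp only at this
        omega
      · have := mod_two_eq hα (hs 0 (by omega)) (hs 1 (by omega)) (Or.inl rfl)
        omega
    · refine Or.inr ⟨fun x y hxy hx => ?_, fun h3 => ?_⟩
      · obtain ⟨j, rfl⟩ := Nat.exists_eq_add_of_le (hxle x y hxy).1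
        have := α.functional _ hxy _ (hs j (by omega)) rfl
        simp only at this
        omega
      · have := mod_two_eq hα (hs 0 (by omega)) (hs 1 (by omega)) (Or.inl rfl)
        omega
  have hB : ((∀ x y, (x, y) ∈ α.graph → i < x → y + i + 1 = t + x) ∧
        (i + 2 ≤ n → (t + i) % 2 = 1)) ∨
      ((∀ x y, (x, y) ∈ α.graph → i < x → y + x = t + n) ∧ (i + 2 ≤ n → t % 2 = 0)) := by
    rcases ht with ht | ht
    · refine Or.inl ⟨fun x y hxy hx => ?_, fun h3 => ?_⟩
      · obtain ⟨j, rfl⟩ := Nat.exists_eq_add_of_le (Nat.succ_le_of_lt hx)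
        have := hxle _ y hxy
        have := α.functional _ hxy _ (ht j (by omega)) rfl
        simp only at this
        omega
      · have := mod_two_eq hα (ht 0 (by omega)) (ht 1 (by omega)) (Or.inl rfl)
        omega
    · refine Or.inr ⟨fun x y hxy hx => ?_, fun h3 => ?_⟩
      · obtain ⟨j, rfl⟩ := Nat.exists_eq_add_of_le (Nat.succ_le_of_lt hx)
        have := hxle _ y hxy
        have := α.functional _ hxy _ (ht j (by omega)) rfl
        simp only at this
        omega
      · have := mod_two_eq hα (ht 0 (by omega)) (ht 1 (by omega)) (Or.inl rfl)
        omega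
  have hcases : ((i = 1 ∨ s = 1) ∧ (i = n ∨ t = i + 1)) ∨
      (i = 2 ∧ s = n ∧ (i = n ∨ t = 1)) ∨ (i = n - 1 ∧ t = 1 ∧ (i = 1 ∨ s = 3)) := by
    have hA' : 3 ≤ i → s % 2 = 1 ∨ (s + i) % 2 = 1 := fun h =>
      hA.imp (fun hA => hA.2 h) (fun hA => hA.2 h)
    have hB' : i + 2 ≤ n → (t + i) % 2 = 1 ∨ t % 2 = 0 := fun h =>
      hB.imp (fun hB => hB.2 h) (fun hB => hB.2 h)
    clear hs ht hA hB hs' ht' hsep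
    rcases horder with h | h | h | h
    · by_cases h2 : n = 2 <;> omega
    · by_cases h2 : n = 2 <;> omega
    · exact Or.inl ⟨by omega, by omega⟩
    · by_cases h2 : i = 2
      · exact Or.inr (Or.inl ⟨h2, by omega, by omega⟩)
      · exact Or.inr (Or.inr ⟨by omega, by omega, by omega⟩)
  rcases hcases with ⟨h1, h2⟩ | ⟨h1, h2, h3⟩ | ⟨h1, h2, h3⟩
  · rcases Nat.even_or_odd i with hi' | hi'
    · have hi2 := Nat.even_iff.1 hi'
      have hid : ∀ x y, (x, y) ∈ α.graph → i < x → y = x := fun x y hxy hx => by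
        have := hxle x y hxy
        rcases hB with ⟨hB, hB2⟩ | ⟨hB, hB2⟩ <;> have := hB x y hxy hx <;> omega
      rcases hA with ⟨hA, hA2⟩ | ⟨hA, hA2⟩
      · refine Or.inl fun x y hxy => ?_
        have := hxle x y hxy
        have := hA x y hxy
        have := hid x y hxy
        omega
      · refine Or.inr (Or.inl ⟨hi', ?_⟩)
        refine graph_eq_of_dom hi hdom (f := fun x => if x < i then i - x else x)
          fun x y hxy => ?_
        have := hxle x y hxy
        have := hA x y hxy
        have := hid x y hxy
        split_ifs <;> omega
    · have hi2 := Nat.odd_iff.1 hi'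
      have hid : ∀ x y, (x, y) ∈ α.graph → x < i → y = x := fun x y hxy hx => by
        have := hxle x y hxy
        rcases hA with ⟨hA, hA2⟩ | ⟨hA, hA2⟩ <;> have := hA x y hxy hx <;> omega
      rcases hB with ⟨hB, hB2⟩ | ⟨hB, hB2⟩
      · refine Or.inl fun x y hxy => ?_
        have := hxle x y hxy
        have := hB x y hxy
        have := hid x y hxy
        omega
      · refine Or.inr (Or.inr (Or.inl ⟨hi', ?_⟩))
        refine graph_eq_of_dom hi hdom (f := fun x => if x < i then x else n + i + 1 - x)
          fun x y hxy => ?_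
        have := hxle x y hxy
        have := hB x y hxy
        have := hid x y hxy
        split_ifs <;> omega
  · refine Or.inr (Or.inr (Or.inr (Or.inl ⟨h1, ?_⟩)))
    subst h1
    refine graph_eq_of_dom hi hdom (f := fun x => if x = 1 then n else x - 2) fun x y hxy => ?_
    have := hxle x y hxy
    rcases hA with ⟨hA, hA2⟩ | ⟨hA, hA2⟩ <;> rcases hB with ⟨hB, hB2⟩ | ⟨hB, hB2⟩ <;>
      have := hA x y hxy <;> have := hB x y hxy <;> split_ifs <;> omega
  · refine Or.inr (Or.inr (Or.inr (Or.inr ⟨h1, ?_⟩)))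
    subst h1
    refine graph_eq_of_dom hi hdom (f := fun x => if x = n then 1 else x + 2) fun x y hxy => ?_
    have := hxle x y hxy
    rcases hA with ⟨hA, hA2⟩ | ⟨hA, hA2⟩ <;> rcases hB with ⟨hB, hB2⟩ | ⟨hB, hB2⟩ <;>
      have := hA x y hxy <;> have := hB x y hxy <;> split_ifs <;> omega

/-- If every element of `IF_n` defined on `X_n ∖ {i}` is a restriction of the identity or equals
`g`, then `g` is irreducible. -/
theorem irreducible_of_dom {g : PartialInj n} {i : ℕ}
    (hg : ∀ x, x ∈ g.dom ↔ 1 ≤ x ∧ x ≤ n ∧ x ≠ i)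
    (hgid : ∃ x y, (x, y) ∈ g.graph ∧ y ≠ x)
    (hclass : ∀ α ∈ IFset n, (∀ x, 1 ≤ x → x ≤ n → x ≠ i → x ∈ α.dom) →
      (∀ x y, (x, y) ∈ α.graph → y = x) ∨ α = g)
    {α β : PartialInj n} (hα : α ∈ IFset n) (hβ : β ∈ IFset n) (h : α * β = g) :
    α = g ∨ β = g := by
  have hαdom : ∀ x, 1 ≤ x → x ≤ n → x ≠ i → x ∈ α.dom := fun x h1 h2 h3 => by
    obtain ⟨y, hy⟩ := (hg x).2 ⟨h1, h2, h3⟩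
    rw [← h] at hy
    obtain ⟨z, hz, -⟩ := hy
    exact ⟨z, hz⟩
  rcases hclass α hα hαdom with hid | rfl
  · have hsub : ∀ x y, (x, y) ∈ g.graph → (x, y) ∈ β.graph := fun x y hxy => by
      rw [← h] at hxy
      obtain ⟨z, hz, hzy⟩ := hxy
      have := hid _ _ hz
      simp only at this hzy
      rwa [this] at hzy
    refine Or.inr ((hclass β hβ fun x h1 h2 h3 => ?_).resolve_left fun hβid => ?_)
    · obtain ⟨y, hy⟩ := (hg x).2 ⟨h1, h2, h3⟩
      exact ⟨y, hsub x y hy⟩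
    · obtain ⟨x, y, hxy, hne⟩ := hgid
      exact hne (hβid x y (hsub x y hxy))
  · exact Or.inl rfl

/-- An irreducible element belongs to every generating set. -/
theorem mem_of_irreducible {A : Set (PartialInj n)}
    (hA : (Subsemigroup.closure A : Set (PartialInj n)) = IFset n) {g : PartialInj n}
    (hg : g ∈ IFset n)
    (hirr : ∀ α ∈ IFset n, ∀ β ∈ IFset n, α * β = g → α = g ∨ β = g) : g ∈ A := by
  rw [← hA] at hg
  suffices h : ∀ x ∈ Subsemigroup.closure A, x = g → g ∈ A from h g hg rfl
  intro x hx
  induction hx using Subsemigroup.closure_induction with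
  | mem x hx => exact fun h => h ▸ hx
  | mul x y hx hy ihx ihy =>
    intro h
    have hmem : ∀ z ∈ Subsemigroup.closure A, z ∈ IFset n := fun z hz => hA ▸ hz
    rcases hirr x (hmem x hx) y (hmem y hy) h with h | h
    · exact ihx h
    · exact ihy h

theorem one_irreducible (hn : Even n) (hn0 : 0 < n) {α β : PartialInj n} (hα : α ∈ IFset n)
    (h : α * β = 1) : α = 1 := by
  refine eq_one_of_full_dom hn hn0 hα fun x h1 h2 => ?_
  have hx : (x, x) ∈ (1 : PartialInj n).graph := ⟨⟨h1, h2⟩, ⟨h1, h2⟩, rfl⟩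
  rw [← h] at hx
  obtain ⟨z, hz, -⟩ := hx
  exact ⟨z, hz⟩

/-- The elements of `IF_n` defined on `X_n ∖ {i}`. -/
theorem graph_eq_generator_of_subset_dom (hn : Even n) (hn0 : 0 < n) (hα : α ∈ IFset n)
    {i : ℕ} (hi1 : 1 ≤ i) (hin : i ≤ n) (hdom : ∀ x, 1 ≤ x → x ≤ n → x ≠ i → x ∈ α.dom) :
    (∀ x y, (x, y) ∈ α.graph → y = x) ∨
    (Even i ∧ α.graph = gammaGraph n i) ∨ (Odd i ∧ α.graph = deltaGraph n i) ∨
    (i = 2 ∧ α.graph = sigma1Graph n) ∨ (i = n - 1 ∧ α.graph = sigma2Graph n) := by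
  by_cases hi : i ∈ α.dom
  · refine Or.inl fun x y hxy => eq_of_full_dom hn hn0 hα (fun z h1 h2 => ?_) hxy
    rcases eq_or_ne z i with rfl | h
    · exact hi
    · exact hdom z h1 h2 h
  · exact graph_eq_generator_of_dom hn hn0 hα hi1 hin hi hdom

end Irreducible

section Generators

variable {n : ℕ} {g : PartialInj n}

theorem mem_dom_of_graph {i : ℕ} {f : ℕ → ℕ}
    (hg : g.graph = {q | 1 ≤ q.1 ∧ q.1 ≤ n ∧ q.1 ≠ i ∧ q.2 = f q.1}) (x : ℕ) :
    x ∈ g.dom ↔ 1 ≤ x ∧ x ≤ n ∧ x ≠ i := by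
  simp only [dom, hg, Set.mem_ofPred_eq]
  exact ⟨fun ⟨y, h1, h2, h3, _⟩ => ⟨h1, h2, h3⟩, fun ⟨h1, h2, h3⟩ => ⟨_, h1, h2, h3, rfl⟩⟩

theorem sigma1_mem_IFset (hn : Even n) (hg : g.graph = sigma1Graph n) : g ∈ IFset n := by
  rw [Nat.even_iff] at hn
  constructor <;> rintro ⟨x, y⟩ h ⟨x', y'⟩ h' hf <;>
    simp only [inv, hg, sigma1Graph, Set.mem_ofPred_eq, fenceLt, Nat.even_iff] at h h' hf ⊢ <;>
    obtain ⟨h1, h2, h3, h4⟩ := h <;> obtain ⟨h1', h2', h3', h4'⟩ := h' <;>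
    split_ifs at h4 h4' <;> omega

theorem sigma2_mem_IFset (hn : Even n) (hg : g.graph = sigma2Graph n) : g ∈ IFset n := by
  rw [Nat.even_iff] at hn
  constructor <;> rintro ⟨x, y⟩ h ⟨x', y'⟩ h' hf <;>
    simp only [inv, hg, sigma2Graph, Set.mem_ofPred_eq, fenceLt, Nat.even_iff] at h h' hf ⊢ <;>
    obtain ⟨h1, h2, h3, h4⟩ := h <;> obtain ⟨h1', h2', h3', h4'⟩ := h' <;>
    split_ifs at h4 h4' <;> omega

theorem gamma_mem_IFset {i : ℕ} (hi : Even i) (hg : g.graph = gammaGraph n i) :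
    g ∈ IFset n := by
  rw [Nat.even_iff] at hi
  constructor <;> rintro ⟨x, y⟩ h ⟨x', y'⟩ h' hf <;>
    simp only [inv, hg, gammaGraph, Set.mem_ofPred_eq, fenceLt, Nat.even_iff] at h h' hf ⊢ <;>
    obtain ⟨h1, h2, h3, h4⟩ := h <;> obtain ⟨h1', h2', h3', h4'⟩ := h' <;>
    split_ifs at h4 h4' <;> omega

theorem delta_mem_IFset (hn : Even n) {i : ℕ} (hi : Odd i) (hg : g.graph = deltaGraph n i) :
    g ∈ IFset n := by
  rw [Nat.even_iff] at hn
  rw [Nat.odd_iff] at hi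
  constructor <;> rintro ⟨x, y⟩ h ⟨x', y'⟩ h' hf <;>
    simp only [inv, hg, deltaGraph, Set.mem_ofPred_eq, fenceLt, Nat.even_iff] at h h' hf ⊢ <;>
    obtain ⟨h1, h2, h3, h4⟩ := h <;> obtain ⟨h1', h2', h3', h4'⟩ := h' <;>
    split_ifs at h4 h4' <;> omega

theorem sigma1_irreducible (hn : Even n) (hn0 : 0 < n) (hg : g.graph = sigma1Graph n)
    {α β : PartialInj n} (hα : α ∈ IFset n) (hβ : β ∈ IFset n) (h : α * β = g) :
    α = g ∨ β = g := by
  have hn' := Nat.even_iff.1 hn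
  refine irreducible_of_dom (i := 2)
    (mem_dom_of_graph (f := fun x => if x = 1 then n else x - 2) hg)
    ⟨1, n, by simp [hg, sigma1Graph]; omega, by omega⟩ (fun α hα hdom => ?_) hα hβ h
  rcases graph_eq_generator_of_subset_dom hn hn0 hα (by omega) (by omega) hdom with
    h | ⟨-, h⟩ | ⟨h, -⟩ | ⟨-, h⟩ | ⟨h, -⟩
  · exact Or.inl h
  · refine Or.inl fun x y hxy => ?_
    rw [h] at hxy
    obtain ⟨h1, h2, h3, h4⟩ := hxy
    simp only at h1 h2 h3 h4
    split_ifs at h4 <;> omega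
  · exact absurd h (by decide)
  · exact Or.inr (ext' (h.trans hg.symm))
  · omega

theorem sigma2_irreducible (hn : Even n) (hn0 : 0 < n) (hg : g.graph = sigma2Graph n)
    {α β : PartialInj n} (hα : α ∈ IFset n) (hβ : β ∈ IFset n) (h : α * β = g) :
    α = g ∨ β = g := by
  have hn' := Nat.even_iff.1 hn
  refine irreducible_of_dom (i := n - 1)
    (mem_dom_of_graph (f := fun x => if x = n then 1 else x + 2) hg)
    ⟨n, 1, by simp [hg, sigma2Graph]; omega, by omega⟩ (fun α hα hdom => ?_) hα hβ h
  rcases graph_eq_generator_of_subset_dom hn hn0 hα (by omega) (by omega) hdom with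
    h | ⟨h, -⟩ | ⟨-, h⟩ | ⟨h, -⟩ | ⟨-, h⟩
  · exact Or.inl h
  · rw [Nat.even_iff] at h
    omega
  · refine Or.inl fun x y hxy => ?_
    rw [h] at hxy
    obtain ⟨h1, h2, h3, h4⟩ := hxy
    simp only at h1 h2 h3 h4
    split_ifs at h4 <;> omega
  · omega
  · exact Or.inr (ext' (h.trans hg.symm))

theorem gamma_irreducible (hn : Even n) (hn0 : 0 < n) {i : ℕ} (hi : Even i) (hi4 : 4 ≤ i)
    (hin : i ≤ n) (hg : g.graph = gammaGraph n i)
    {α β : PartialInj n} (hα : α ∈ IFset n) (hβ : β ∈ IFset n) (h : α * β = g) :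
    α = g ∨ β = g := by
  have hn' := Nat.even_iff.1 hn
  refine irreducible_of_dom (i := i)
    (mem_dom_of_graph (f := fun x => if x < i then i - x else x) hg)
    ⟨1, i - 1, by simp [hg, gammaGraph]; omega, by omega⟩ (fun α hα hdom => ?_) hα hβ h
  rcases graph_eq_generator_of_subset_dom hn hn0 hα (by omega) (by omega) hdom with
    h | ⟨-, h⟩ | ⟨h, -⟩ | ⟨h, -⟩ | ⟨h, -⟩
  · exact Or.inl h
  · exact Or.inr (ext' (h.trans hg.symm))
  all_goals grind

theorem delta_irreducible (hn : Even n) (hn0 : 0 < n) {i : ℕ} (hi : Odd i) (hin : i ≤ n - 3)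
    (hg : g.graph = deltaGraph n i)
    {α β : PartialInj n} (hα : α ∈ IFset n) (hβ : β ∈ IFset n) (h : α * β = g) :
    α = g ∨ β = g := by
  have hn' := Nat.even_iff.1 hn
  have hi' := Nat.odd_iff.1 hi
  refine irreducible_of_dom (i := i)
    (mem_dom_of_graph (f := fun x => if x < i then x else n + i + 1 - x) hg)
    ⟨n, i + 1, by simp only [hg, deltaGraph, Set.mem_ofPred_eq]; split_ifs <;> omega,
      by omega⟩ (fun α hα hdom => ?_) hα hβ h
  rcases graph_eq_generator_of_subset_dom hn hn0 hα (by omega) (by omega) hdom with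
    h | ⟨h, -⟩ | ⟨-, h⟩ | ⟨h, -⟩ | ⟨h, -⟩
  · exact Or.inl h
  · grind
  · exact Or.inr (ext' (h.trans hg.symm))
  · omega
  · omega

end Generators

section Words

/-- The flattening of a word whose letters are blocks: each block is followed by a separator `0`. -/
def flat : List (List ℕ) → List ℕ
  | [] => []
  | b :: w => b ++ 0 :: flat w

/-- The length of the flattening of a word. -/
def len (w : List (List ℕ)) : ℕ := (flat w).length

/-- The reversal of a word, which also reverses all of its blocks. -/
def rev (w : List (List ℕ)) : List (List ℕ) := (w.map List.reverse).reverse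

theorem flat_append (x y : List (List ℕ)) : flat (x ++ y) = flat x ++ flat y := by
  induction x with
  | nil => rfl
  | cons b x ih => simp [flat, ih]

theorem len_nil : len [] = 0 := rfl

theorem len_cons (b : List ℕ) (w : List (List ℕ)) : len (b :: w) = b.length + 1 + len w := by
  simp [len, flat]
  omega

theorem len_append (x y : List (List ℕ)) : len (x ++ y) = len x + len y := by
  simp [len, flat_append]

theorem rev_append (x y : List (List ℕ)) : rev (x ++ y) = rev y ++ rev x := by simp [rev]

theorem rev_rev (x : List (List ℕ)) : rev (rev x) = x := by
  simp [rev]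

theorem rev_singleton (b : List ℕ) : rev [b] = [b.reverse] := rfl

theorem zero_cons_flat_rev (w : List (List ℕ)) : 0 :: flat (rev w) = (0 :: flat w).reverse := by
  induction w with
  | nil => rfl
  | cons b w ih =>
    rw [← List.singleton_append (l := w), rev_append, flat_append, ← List.cons_append, ih]
    simp [flat, rev]

theorem flat_rev_perm (w : List (List ℕ)) : (flat (rev w)).Perm (flat w) := by
  have h := List.reverse_perm (0 :: flat w)
  rw [← zero_cons_flat_rev] at h
  exact h.cons_inv

theorem len_rev (w : List (List ℕ)) : len (rev w) = len w := (flat_rev_perm w).length_eq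

theorem mem_flat {v : ℕ} (hv : v ≠ 0) {w : List (List ℕ)} : v ∈ flat w ↔ ∃ b ∈ w, v ∈ b := by
  induction w with
  | nil => simp [flat]
  | cons b w ih => simp [flat, ih, hv]

theorem getElem?_separator (x y : List (List ℕ)) :
    (0 :: flat (x ++ y))[len x]? = some 0 := by
  induction x with
  | nil => rfl
  | cons b x ih =>
    have h : 0 :: flat (b :: x ++ y) = (0 :: b) ++ (0 :: flat (x ++ y)) := by simp [flat]
    rw [h, len_cons, List.getElem?_append_right (by simp), ← ih]
    congr 1
    simp

theorem getElem?_block (x : List (List ℕ)) (b : List ℕ) (y : List (List ℕ)) {j : ℕ}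
    (hj : j < b.length) : (0 :: flat (x ++ b :: y))[len x + 1 + j]? = some b[j] := by
  rw [show len x + 1 + j = len x + j + 1 by omega, List.getElem?_cons_succ, flat_append,
    List.getElem?_append_right (by simp [len]), flat,
    List.getElem?_append_left (by simp [len]; omega), List.getElem?_eq_some_iff]
  exact ⟨by simp [len]; omega, by simp [len]⟩

theorem exists_flat_eq (l : List ℕ) : ∃ w, flat w = l ++ [0] ∧ ∀ b ∈ w, 0 ∉ b := by
  induction l with
  | nil => exact ⟨[[]], rfl, by simp⟩
  | cons a l ih =>
    obtain ⟨w, hw, hw0⟩ := ih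
    by_cases ha : a = 0
    · exact ⟨[] :: w, by simp [flat, hw, ha], by simpa using hw0⟩
    · cases w with
      | nil => simp [flat] at hw
      | cons b w =>
        refine ⟨(a :: b) :: w, by simpa [flat] using hw, fun c hc => ?_⟩
        rcases List.mem_cons.1 hc with rfl | hc
        · have := hw0 b (by simp)
          simp [this, Ne.symm ha]
        · exact hw0 c (by simp [hc])

/-- The elementary transformations of words of total length `N`: reversing an initial or a final
segment of even length, and moving a block of size one from the beginning to the end. -/
structure WordMoves (N : ℕ) (R : List (List ℕ) → List (List ℕ) → Prop) : Prop where
  equiv : Equivalence R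
  pre : ∀ x y, len (x ++ y) = N → Even (len x) → R (x ++ y) (rev x ++ y)
  suf : ∀ x y, len (x ++ y) = N → Even (len y) → R (x ++ y) (x ++ rev y)
  rot : ∀ a w, len ([a] :: w) = N → R ([a] :: w) (w ++ [[a]])

namespace WordMoves

variable {N : ℕ} {R : List (List ℕ) → List (List ℕ) → Prop}

theorem reverse_infix (h : WordMoves N R) (hN : Odd N) (x u y : List (List ℕ))
    (hlen : len x + len u + len y = N) (hu : Even (len u)) :
    R (x ++ (u ++ y)) (x ++ (rev u ++ y)) := by
  rw [Nat.even_iff] at hu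
  rw [Nat.odd_iff] at hN
  rcases Nat.even_or_odd (len x) with hx | hx
  · rw [Nat.even_iff] at hx
    have h1 := h.pre (x ++ u) y (by simp only [len_append]; omega)
      (by simp only [len_append, Nat.even_iff]; omega)
    have h2 := h.pre (rev u) (rev x ++ y) (by simp only [len_append, len_rev]; omega)
      (by simp only [len_rev, Nat.even_iff]; omega)
    have h3 := h.pre (u ++ rev x) y (by simp only [len_append, len_rev]; omega)
      (by simp only [len_append, len_rev, Nat.even_iff]; omega)
    simp only [rev_append, rev_rev, List.append_assoc] at h1 h2 h3
    exact h.equiv.trans h1 (h.equiv.trans h2 h3)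
  · rw [Nat.odd_iff] at hx
    have h1 := h.suf x (u ++ y) (by simp only [len_append]; omega)
      (by simp only [len_append, Nat.even_iff]; omega)
    have h2 := h.suf (x ++ rev y) (rev u) (by simp only [len_append, len_rev]; omega)
      (by simp only [len_rev, Nat.even_iff]; omega)
    have h3 := h.suf x (rev y ++ u) (by simp only [len_append, len_rev]; omega)
      (by simp only [len_append, len_rev, Nat.even_iff]; omega)
    simp only [rev_append, rev_rev, List.append_assoc] at h1 h2 h3
    exact h.equiv.trans h1 (h.equiv.trans h2 h3)

theorem swap (h : WordMoves N R) (hN : Odd N) (x u w y : List (List ℕ))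
    (hlen : len x + len u + len w + len y = N) (hu : Even (len u)) (hw : Even (len w)) :
    R (x ++ (u ++ (w ++ y))) (x ++ (w ++ (u ++ y))) := by
  have h1 := h.reverse_infix hN x (u ++ w) y (by simp only [len_append]; omega)
    (by simp only [len_append]; exact hu.add hw)
  have h2 := h.reverse_infix hN x (rev w) (rev u ++ y)
    (by simp only [len_append, len_rev]; omega) (by simpa only [len_rev])
  have h3 := h.reverse_infix hN (x ++ w) (rev u) y
    (by simp only [len_append, len_rev]; omega) (by simpa only [len_rev])
  simp only [rev_append, rev_rev, List.append_assoc] at h1 h2 h3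
  exact h.equiv.trans h1 (h.equiv.trans h2 h3)

theorem singleton_comm (h : WordMoves N R) (hN : Odd N) (x : List (List ℕ)) (a : ℕ)
    (w y : List (List ℕ)) (hlen : len x + 2 + len w + len y = N) :
    R (x ++ (w ++ ([[a]] ++ y))) (x ++ ([[a]] ++ (w ++ y))) := by
  have ha : len [[a]] = 2 := rfl
  refine h.equiv.symm ?_
  rw [Nat.odd_iff] at hN
  by_cases hw : Even (len w)
  · exact h.swap (Nat.odd_iff.2 hN) x [[a]] w y (by omega) (by rw [ha]; decide) hw
  rw [Nat.even_iff] at hw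
  have hrot := h.rot a (x ++ (w ++ y)) (by simp only [len_cons, len_append, List.length]; omega)
  by_cases hx : Even (len x)
  · have hx' := Nat.even_iff.1 hx
    have h1 := h.swap (Nat.odd_iff.2 hN) [] x [[a]] (w ++ y)
      (by simp only [len_nil, len_append]; omega) hx (by rw [ha]; decide)
    have h2 := h.swap (Nat.odd_iff.2 hN) (x ++ w) y [[a]] []
      (by simp only [len_nil, len_append]; omega) (by rw [Nat.even_iff]; omega)
      (by rw [ha]; decide)
    simp only [List.append_assoc, List.nil_append, List.append_nil, List.cons_append]
      at h1 h2 hrot ⊢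
    exact h.equiv.trans h1 (h.equiv.trans hrot h2)
  · rw [Nat.even_iff] at hx
    have h1 := h.swap (Nat.odd_iff.2 hN) x [[a]] (w ++ y) []
      (by simp only [len_nil, len_append]; omega) (by rw [ha]; decide)
      (by rw [Nat.even_iff, len_append]; omega)
    have h2 := h.swap (Nat.odd_iff.2 hN) [] [[a]] (x ++ w) y
      (by simp only [len_nil, len_append]; omega) (by rw [ha]; decide)
      (by rw [Nat.even_iff, len_append]; omega)
    simp only [List.append_assoc, List.nil_append, List.append_nil, List.cons_append]
      at h1 h2 hrot ⊢
    exact h.equiv.trans h1 (h.equiv.trans (h.equiv.symm hrot) h2)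

theorem swap_even_blocks (h : WordMoves N R) (hN : Odd N) (x : List (List ℕ)) (e : List ℕ)
    (w : List (List ℕ)) (f : List ℕ) (y : List (List ℕ))
    (hlen : len (x ++ (e :: (w ++ f :: y))) = N) (he : Even e.length) (hf : Even f.length)
    (hw : Even (len w)) :
    R (x ++ (e :: (w ++ f :: y))) (x ++ (f.reverse :: (w ++ e.reverse :: y))) := by
  rw [Nat.even_iff] at he hf hw
  simp only [len_append, len_cons] at hlen
  have h1 := h.reverse_infix hN x ([e] ++ (w ++ [f])) y
    (by simp only [len_append, len_cons, len_nil]; omega)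
    (by simp only [len_append, len_cons, len_nil, Nat.even_iff]; omega)
  have h2 := h.reverse_infix hN (x ++ [f.reverse]) (rev w) ([e.reverse] ++ y)
    (by simp only [len_append, len_cons, len_nil, len_rev, List.length_reverse]; omega)
    (by simp only [len_rev, Nat.even_iff]; omega)
  rw [rev_append, rev_append] at h1
  simp only [rev_rev, rev_singleton, List.append_assoc, List.cons_append, List.nil_append]
    at h1 h2
  exact h.equiv.trans h1 h2

theorem exists_even_block {x : List (List ℕ)} (hx : Odd (len x)) :
    ∃ x₁ e x₂, x = x₁ ++ e :: x₂ ∧ Even e.length ∧ Even (len x₁) := by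
  induction x with
  | nil => simp [len_nil] at hx
  | cons b x ih =>
    by_cases hb : Even b.length
    · exact ⟨[], b, x, rfl, hb, by simp [len_nil]⟩
    · obtain ⟨x₁, e, x₂, rfl, he, hx₁⟩ := ih (by
        rw [len_cons] at hx
        grind)
      exact ⟨b :: x₁, e, x₂, rfl, he, by rw [len_cons]; grind⟩

theorem even_block_to_front (h : WordMoves N R) (hN : Odd N) (z : List (List ℕ)) (d : List ℕ)
    (x : List (List ℕ)) (c : List ℕ) (y : List (List ℕ))
    (hlen : len (z ++ (d :: (x ++ c :: y))) = N) (hd : Even d.length) (hc : Even c.length) :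
    ∃ v c', (c' = c ∨ c' = c.reverse) ∧ R (z ++ (d :: (x ++ c :: y))) (z ++ c' :: v) := by
  rcases Nat.even_or_odd (len x) with hx | hx
  · exact ⟨_, _, Or.inr rfl, h.swap_even_blocks hN z d x c y hlen hd hc hx⟩
  · obtain ⟨x₁, e, x₂, rfl, he, hx₁⟩ := exists_even_block hx
    have hx₂ : Even (len x₂) := by
      rw [len_append, len_cons] at hx
      grind
    simp only [len_append, len_cons] at hlen
    have h1 := h.swap_even_blocks hN (z ++ d :: x₁) e x₂ c y
      (by simp only [len_append, len_cons]; omega) he hc hx₂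
    have h2 := h.swap_even_blocks hN z d x₁ c.reverse (x₂ ++ e.reverse :: y)
      (by simp only [len_append, len_cons, List.length_reverse]; omega) hd (by simpa) hx₁
    simp only [List.append_assoc, List.cons_append] at h1 h2 ⊢
    exact ⟨_, _, Or.inl (List.reverse_reverse c), h.equiv.trans h1 h2⟩

end WordMoves

end Words

section Realization

variable {n : ℕ}

/-- The word `w` describes `α`: the entry of its flattening at position `y` is the preimage of `y`
under `α`, or `0` if `y` is not in the image. -/
def Describes (w : List (List ℕ)) (α : PartialInj n) : Prop :=
  len w = n + 1 ∧ (∀ b ∈ w, 0 ∉ b) ∧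
    ∀ v y, (v, y) ∈ α.graph ↔ v ≠ 0 ∧ (0 :: flat w)[y]? = some v

/-- The word `w` describes an element of `T`. -/
def Realized (T : Set (PartialInj n)) (w : List (List ℕ)) : Prop := ∃ α ∈ T, Describes w α

/-- Increasing or decreasing runs of consecutive integers. -/
def IsRun (b : List ℕ) : Prop :=
  ∃ i, b = List.range' i b.length ∨ b = (List.range' i b.length).reverse

theorem IsRun.head?_parity {b : List ℕ} (hb : IsRun b) {v v' : ℕ} (hv : b.head? = some v)
    (hv' : b.reverse.head? = some v') : (v + v' + b.length) % 2 = 1 := by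
  have hb0 : b.length ≠ 0 := by
    rintro h0
    simp [List.length_eq_zero_iff.1 h0] at hv
  obtain ⟨i, hb | hb⟩ := hb <;> rw [hb] at hv hv' <;>
    simp [List.head?_range', List.getLast?_range'] at hv hv' <;> omega

variable {x y : List (List ℕ)} {b : List ℕ}

theorem Describes.mem_graph {α : PartialInj n} (h : Describes (x ++ b :: y) α) {j : ℕ}
    (hj : j < b.length) : (b[j], len x + 1 + j) ∈ α.graph :=
  (h.2.2 _ _).2 ⟨fun h0 => h.2.1 b (by simp) (h0 ▸ List.getElem_mem hj), getElem?_block x b y hj⟩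

theorem Realized.isRun (h : Realized (IFset n) (x ++ b :: y)) (hn : 0 < n) : IsRun b := by
  obtain ⟨α, hα, h⟩ := h
  obtain ⟨s, -, -, hs⟩ := interval_image (inv_mem_IFset hα) hn (len x + 1) b.length
    fun j hj => ⟨b[j], h.mem_graph hj⟩
  refine ⟨s, hs.imp (fun hs => ?_) fun hs => ?_⟩
  · refine List.ext_getElem (by simp) fun j hj _ => ?_
    have := α.injOn _ (h.mem_graph hj) _ (hs j hj) rfl
    simpa using this
  · refine List.ext_getElem (by simp) fun j hj _ => ?_
    have := α.injOn _ (h.mem_graph hj) _ (hs j hj) rfl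
    simpa using this

theorem Realized.head?_parity (h : Realized (IFset n) (x ++ b :: y)) (hb : 2 ≤ b.length) {v : ℕ}
    (hv : b.head? = some v) : (v + len x) % 2 = 1 := by
  obtain ⟨α, hα, h⟩ := h
  have h0 := mod_two_eq (inv_mem_IFset hα) (h.mem_graph (j := 0) (by omega))
    (h.mem_graph (j := 1) (by omega)) (Or.inl rfl)
  rw [List.head?_eq_getElem?, List.getElem?_eq_some_iff] at hv
  obtain ⟨_, hv⟩ := hv
  rw [hv] at h0
  omega

theorem Realized.mem_of_adj (h : Realized (IFset n) (x ++ b :: y)) {v v' : ℕ} (hv : v ∈ b)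
    (hv0 : v' ≠ 0) (hv' : v' ∈ flat (x ++ b :: y)) (hadj : v + 1 = v' ∨ v' + 1 = v) : v' ∈ b := by
  obtain ⟨α, hα, h⟩ := h
  obtain ⟨j, hj, rfl⟩ := List.getElem_of_mem hv
  obtain ⟨q, hq⟩ := List.getElem?_of_mem (List.mem_cons_of_mem 0 hv')
  have h1 := (adj_iff hα (h.mem_graph hj) ((h.2.2 v' q).2 ⟨hv0, hq⟩)).1 hadj
  rcases h1 with h1 | h1
  · by_cases hj1 : j + 1 < b.length
    · have := getElem?_block x b y hj1
      rw [show len x + 1 + (j + 1) = q by omega, hq, Option.some_inj] at this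
      rw [this]
      exact List.getElem_mem hj1
    · have := getElem?_separator (x ++ [b]) y
      rw [len_append, len_cons, len_nil, show len x + (b.length + 1 + 0) = q by omega,
        List.append_assoc, List.singleton_append, hq, Option.some_inj] at this
      exact absurd this hv0
  · rcases Nat.eq_zero_or_pos j with rfl | hj0
    · have := getElem?_separator x (b :: y)
      rw [show len x = q by omega, hq, Option.some_inj] at this
      exact absurd this hv0
    · have := getElem?_block x b y (j := j - 1) (by omega)
      rw [show len x + 1 + (j - 1) = q by omega, hq, Option.some_inj] at this
      rw [this]
      exact List.getElem_mem _

theorem IsRun.exists_mem_iff (hb : IsRun b) : ∃ i, ∀ v, v ∈ b ↔ i ≤ v ∧ v < i + b.length := by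
  obtain ⟨i, hb | hb⟩ := hb <;> refine ⟨i, fun v => ?_⟩
  · conv_lhs => rw [hb]
    rw [List.mem_range'_1]
  · conv_lhs => rw [hb]
    rw [List.mem_reverse, List.mem_range'_1]

theorem IsRun.eq_or_eq_reverse {c : List ℕ} (hb : IsRun b) (hc : IsRun c)
    (h : ∀ v, v ∈ b ↔ v ∈ c) : c = b ∨ c = b.reverse := by
  have hlen : b.Nodup → c.Nodup → b.length = c.length := fun h1 h2 =>
    ((List.perm_ext_iff_of_nodup h1 h2).2 h).length_eq
  obtain ⟨i, hb⟩ := hb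
  obtain ⟨j, hc⟩ := hc
  have hlen := hlen
    (by rcases hb with hb | hb <;> rw [hb] <;> simp [List.nodup_range'])
    (by rcases hc with hc | hc <;> rw [hc] <;> simp [List.nodup_range'])
  rw [← hlen] at hc
  generalize b.length = k at *
  have hij : k = 0 ∨ i = j := by
    have hbm : ∀ v, v ∈ b ↔ i ≤ v ∧ v < i + k := fun v => by
      rcases hb with rfl | rfl <;> simp [List.mem_range'_1]
    have hcm : ∀ v, v ∈ c ↔ j ≤ v ∧ v < j + k := fun v => by
      rcases hc with rfl | rfl <;> simp [List.mem_range'_1]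
    have h1 := h i
    have h2 := h j
    rw [hbm, hcm] at h1 h2
    omega
  rcases hij with rfl | rfl
  · left
    rcases hb with rfl | rfl <;> rcases hc with rfl | rfl <;> rfl
  · rcases hb with rfl | rfl <;> rcases hc with rfl | rfl <;> simp

theorem Realized.ne_zero {T : Set (PartialInj n)} (h : Realized T (x ++ b :: y)) {v : ℕ}
    (hv : v ∈ b) : v ≠ 0 := by
  obtain ⟨α, -, h⟩ := h
  rintro rfl
  exact h.2.1 b (by simp) hv

theorem Realized.block_subset {x' y' : List (List ℕ)} {c : List ℕ} (hn : 0 < n)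
    (h : Realized (IFset n) (x ++ b :: y)) (h' : Realized (IFset n) (x' ++ c :: y'))
    (hperm : (flat (x ++ b :: y)).Perm (flat (x' ++ c :: y'))) {v : ℕ} (hb : v ∈ b) (hc : v ∈ c) :
    ∀ u ∈ c, u ∈ b := by
  obtain ⟨i, hi⟩ := (h.isRun hn).exists_mem_iff
  obtain ⟨j, hj⟩ := (h'.isRun hn).exists_mem_iff
  have hstep : ∀ v v', v ∈ b → v' ∈ c → (v + 1 = v' ∨ v' + 1 = v) → v' ∈ b := by
    intro v v' hv hv' hadj
    refine h.mem_of_adj hv (h'.ne_zero hv') (hperm.mem_iff.2 ?_) hadj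
    exact (mem_flat (h'.ne_zero hv')).2 ⟨c, by simp, hv'⟩
  have h1 := hstep i (i - 1)
  have h2 := hstep (i + b.length - 1) (i + b.length)
  intro u hu
  simp only [hi, hj] at *
  omega

/-- Blocks of two words describing elements of `IF_n` with the same domain which share a point
agree up to reversal. -/
theorem Realized.block_unique {x' y' : List (List ℕ)} {c : List ℕ} (hn : 0 < n)
    (h : Realized (IFset n) (x ++ b :: y)) (h' : Realized (IFset n) (x' ++ c :: y'))
    (hperm : (flat (x ++ b :: y)).Perm (flat (x' ++ c :: y'))) {v : ℕ} (hb : v ∈ b) (hc : v ∈ c) :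
    c = b ∨ c = b.reverse :=
  (h.isRun hn).eq_or_eq_reverse (h'.isRun hn) fun u =>
    ⟨h'.block_subset hn h hperm.symm hc hb u, h.block_subset hn h' hperm hb hc u⟩

end Realization

section Connectedness

variable {n : ℕ} {R : List (List ℕ) → List (List ℕ) → Prop}

theorem Realized.len_eq {T : Set (PartialInj n)} {w : List (List ℕ)} (h : Realized T w) :
    len w = n + 1 := by
  obtain ⟨α, -, h⟩ := h
  exact h.1

/-- A nonempty block can be moved to the position which it has in another word. -/
theorem WordMoves.block_to_front (h : WordMoves (n + 1) R) (hn : Even n) (hn0 : 0 < n)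
    (hR : ∀ w w', R w w' → Realized (IFset n) w → Realized (IFset n) w')
    {z u v : List (List ℕ)} {b : List ℕ} (hu : Realized (IFset n) (z ++ b :: u))
    (hv : Realized (IFset n) (z ++ v)) (hperm : (flat (b :: u)).Perm (flat v)) (hb : b ≠ [])
    (hhead : Odd b.length ∨ ∃ d v₁, v = d :: v₁ ∧ Even d.length) :
    ∃ v', R (z ++ v) (z ++ b :: v') := by
  have hN : Odd (n + 1) := hn.add_one
  obtain ⟨e, heb⟩ := List.exists_mem_of_ne_nil b hb
  have he0 := hu.ne_zero heb
  obtain ⟨c, hcv, hec⟩ := (mem_flat he0).1 (hperm.mem_iff.1 ((mem_flat he0).2 ⟨b, by simp, heb⟩))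
  obtain ⟨x, y, rfl⟩ := List.append_of_mem hcv
  have hzperm : (flat (z ++ b :: u)).Perm (flat ((z ++ x) ++ c :: y)) := by
    rw [List.append_assoc, flat_append, flat_append z]
    exact hperm.append_left _
  have hv₀ := hv
  rw [← List.append_assoc] at hv₀
  have hcb := hu.block_unique hn0 hv₀ hzperm heb hec
  have hlen : c.length = b.length := by rcases hcb with rfl | rfl <;> simp
  have hbpos : 0 < b.length := List.length_pos_iff.2 hb
  have hbrun := hu.isRun hn0
  have hvlen := hv.len_eq
  simp only [len_append, len_cons] at hvlen
  have hfront : ∃ v' c', (c' = b ∨ c' = b.reverse) ∧ R (z ++ (x ++ c :: y)) (z ++ c' :: v') := by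
    rcases Nat.even_or_odd b.length with hbe | hodd
    · obtain ⟨d, v₁, hdv, hd⟩ := hhead.resolve_left (Nat.not_odd_iff_even.2 hbe)
      cases x with
      | nil => exact ⟨y, c, hcb, h.equiv.refl _⟩
      | cons d' x =>
        obtain ⟨rfl, rfl⟩ := List.cons_eq_cons.1 hdv
        obtain ⟨v', c', hc', hR'⟩ := h.even_block_to_front hN z d' x c y hv.len_eq hd (hlen ▸ hbe)
        refine ⟨v', c', ?_, hR'⟩
        rcases hcb with rfl | rfl <;> rcases hc' with rfl | rfl <;> simp
    · refine ⟨x ++ y, c, hcb, ?_⟩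
      by_cases hb1 : b.length = 1
      · obtain ⟨a, rfl⟩ := List.length_eq_one_iff.1 (hlen.trans hb1)
        have := h.singleton_comm hN z a x y (by simp only [List.length_singleton] at hvlen; omega)
        simpa using this
      · have hb2 : 2 ≤ b.length := by omega
        have hbhead := hu.head?_parity hb2 (List.head?_eq_some_head hb)
        have hc : c ≠ [] := List.length_pos_iff.1 (by omega)
        have hchead := hv₀.head?_parity (by omega) (List.head?_eq_some_head hc)
        rw [len_append] at hchead
        rw [Nat.odd_iff] at hodd
        have hx : Even (len x) := by
          rw [Nat.even_iff]
          rcases hcb with rfl | rfl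
          · omega
          · have := hbrun.head?_parity (List.head?_eq_some_head hb) (List.head?_eq_some_head hc)
            omega
        have := h.swap hN z x [c] y (by simp only [len_cons, len_nil]; omega) hx
          (by rw [len_cons, len_nil, Nat.even_iff]; omega)
        simpa using this
  obtain ⟨v', c', hc', hR'⟩ := hfront
  rcases hc' with rfl | rfl
  · exact ⟨v', hR'⟩
  have hv' := hR _ _ hR' hv
  by_cases hodd : Odd b.length
  · have hlen' := hv'.len_eq
    simp only [len_append, len_cons] at hlen'
    have := h.reverse_infix hN z [b.reverse] v' (by simp only [len_cons, len_nil]; omega)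
      (by rw [Nat.odd_iff] at hodd; simp only [len_cons, len_nil, Nat.even_iff,
        List.length_reverse]; omega)
    rw [rev_singleton, List.reverse_reverse] at this
    exact ⟨v', h.equiv.trans hR' this⟩
  · rw [Nat.not_odd_iff] at hodd
    have hb' : b.reverse ≠ [] := by simpa
    have h1 := hu.head?_parity (by omega) (List.head?_eq_some_head hb)
    have h2 := hv'.head?_parity (by rw [List.length_reverse]; omega)
      (List.head?_eq_some_head hb')
    have h3 := hbrun.head?_parity (List.head?_eq_some_head hb) (List.head?_eq_some_head hb')
    omega

/-- Words describing elements of `IF_n` with the same domain are connected by elementary moves. -/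
theorem WordMoves.connected (h : WordMoves (n + 1) R) (hn : Even n) (hn0 : 0 < n)
    (hR : ∀ w w', R w w' → Realized (IFset n) w → Realized (IFset n) w')
    (hRperm : ∀ w w', R w w' → (flat w).Perm (flat w')) (u z v : List (List ℕ))
    (hu : Realized (IFset n) (z ++ u)) (hv : Realized (IFset n) (z ++ v))
    (hperm : (flat u).Perm (flat v)) : R (z ++ u) (z ++ v) := by
  induction hk : len u using Nat.strong_induction_on generalizing u z v with
  | _ k ih =>
    have hcancel : ∀ {b u' v'}, k = len (b :: u') → Realized (IFset n) (z ++ b :: u') →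
        Realized (IFset n) (z ++ b :: v') → (flat (b :: u')).Perm (flat (b :: v')) →
        R (z ++ b :: u') (z ++ b :: v') := by
      intro b u' v' hk hu hv hperm
      rw [len_cons] at hk
      have := ih (len u') (by omega) u' (z ++ [b]) v' (by simpa using hu) (by simpa using hv)
        ((List.perm_append_left_iff b).1 (by simpa [flat] using hperm :
          (b ++ 0 :: flat u').Perm (b ++ 0 :: flat v'))).cons_inv rfl
      simpa using this
    have hpermR : ∀ {w w'}, R (z ++ w) (z ++ w') → (flat w).Perm (flat w') := fun hww' => by
      have := hRperm _ _ hww'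
      rw [flat_append, flat_append] at this
      exact (List.perm_append_left_iff _).1 this
    cases u with
    | nil =>
      cases v with
      | nil => exact h.equiv.refl _
      | cons c v => simp [flat] at hperm
    | cons b u =>
      cases v with
      | nil => simp [flat] at hperm
      | cons c v =>
        by_cases hbfront : b ≠ [] ∧ (Odd b.length ∨ Even c.length)
        · obtain ⟨v', hv'⟩ := h.block_to_front hn hn0 hR hu hv hperm hbfront.1
            (hbfront.2.imp id fun hc => ⟨c, v, rfl, hc⟩)
          exact h.equiv.trans (hcancel hk.symm hu (hR _ _ hv' hv) (hperm.trans (hpermR hv')))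
            (h.equiv.symm hv')
        by_cases hcfront : c ≠ [] ∧ (Odd c.length ∨ Even b.length)
        · obtain ⟨u', hu'⟩ := h.block_to_front hn hn0 hR hv hu hperm.symm hcfront.1
            (hcfront.2.imp id fun hb => ⟨b, u, rfl, hb⟩)
          have hk' : k = len (c :: u') := hk.symm.trans (hpermR hu').length_eq
          exact h.equiv.trans hu' (hcancel hk' (hR _ _ hu' hu) hv ((hpermR hu').symm.trans hperm))
        have hbc : b = [] ∧ c = [] := by
          by_cases hb : b = [] <;> by_cases hc : c = [] <;>
            simp [hb, hc] at hbfront hcfront ⊢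
          grind
        obtain ⟨rfl, rfl⟩ := hbc
        exact hcancel hk.symm hu hv hperm

end Connectedness

section Positions

theorem getElem?_rev_append_left (x y : List (List ℕ)) {q : ℕ} (hq : q ≤ len x) :
    (0 :: flat (rev x ++ y))[q]? = (0 :: flat (x ++ y))[len x - q]? := by
  have hx : (0 :: flat x).length = len x + 1 := rfl
  rw [flat_append, flat_append, ← List.cons_append, ← List.cons_append, zero_cons_flat_rev,
    List.getElem?_append_left (by rw [List.length_reverse]; omega),
    List.getElem?_append_left (by omega), List.getElem?_reverse (by omega)]
  congr 1

theorem getElem?_rev_append_right (x y : List (List ℕ)) {q : ℕ} (hq : len x < q) :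
    (0 :: flat (rev x ++ y))[q]? = (0 :: flat (x ++ y))[q]? := by
  have hx : (0 :: flat x).length = len x + 1 := rfl
  rw [flat_append, flat_append, ← List.cons_append, ← List.cons_append, zero_cons_flat_rev,
    List.getElem?_append_right (by rw [List.length_reverse]; omega),
    List.getElem?_append_right (by omega), List.length_reverse]

theorem getElem?_flat_append_left (x y : List (List ℕ)) {q : ℕ} (hq : q ≤ len x) :
    (0 :: flat (x ++ y))[q]? = (0 :: flat x)[q]? := by
  have hx : (0 :: flat x).length = len x + 1 := rfl
  rw [flat_append, ← List.cons_append, List.getElem?_append_left (by omega)]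

theorem getElem?_flat_append_right (x y : List (List ℕ)) (q : ℕ) :
    (0 :: flat (x ++ y))[len x + q]? = (0 :: flat y)[q]? := by
  have hx : (0 :: flat x).length = len x + 1 := rfl
  rcases q with _ | q
  · exact getElem?_separator x y
  · rw [flat_append, ← List.cons_append, List.getElem?_append_right (by omega), hx,
      List.getElem?_cons_succ]
    congr 1
    omega

theorem getElem?_append_rev_right (x y : List (List ℕ)) {q : ℕ} (hq : len x ≤ q)
    (hq' : q ≤ len x + len y) :
    (0 :: flat (x ++ rev y))[q]? = (0 :: flat (x ++ y))[len x + len y + len x - q]? := by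
  have hy : (0 :: flat y).length = len y + 1 := rfl
  obtain ⟨k, rfl⟩ := Nat.exists_eq_add_of_le hq
  rw [getElem?_flat_append_right, zero_cons_flat_rev, List.getElem?_reverse (by omega),
    show len x + len y + len x - (len x + k) = len x + (len y - k) by omega,
    getElem?_flat_append_right]
  congr 1

theorem getElem?_singleton_cons (a : ℕ) (w : List (List ℕ)) (q : ℕ) :
    (0 :: flat ([a] :: w))[2 + q]? = (0 :: flat w)[q]? :=
  getElem?_flat_append_right [[a]] w q

theorem getElem?_len_lt {w : List (List ℕ)} {q v : ℕ} (hv : v ≠ 0)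
    (h : (0 :: flat w)[q]? = some v) : 1 ≤ q ∧ q < len w := by
  have h1 : q ≠ 0 := by
    rintro rfl
    simp at h
    omega
  have h2 : q ≠ len w := by
    rintro rfl
    have := getElem?_separator w []
    rw [List.append_nil, h, Option.some_inj] at this
    exact hv this
  obtain ⟨h3, -⟩ := List.getElem?_eq_some_iff.1 h
  rw [List.length_cons] at h3
  change q < len w + 1 at h3
  omega

end Positions

section Generation

variable {n : ℕ} {α g : PartialInj n} {w w' x y : List (List ℕ)}

theorem Describes.mul (h : Describes w α) (hlen : len w' = n + 1) (h0 : ∀ b ∈ w', 0 ∉ b)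
    (hg : ∀ y q, (y, q) ∈ g.graph → (0 :: flat w')[q]? = (0 :: flat w)[y]?)
    (hg' : ∀ q v, v ≠ 0 → (0 :: flat w')[q]? = some v →
      ∃ y, (0 :: flat w)[y]? = some v ∧ (y, q) ∈ g.graph) : Describes w' (α * g) := by
  refine ⟨hlen, h0, fun v q => ⟨?_, ?_⟩⟩
  · rintro ⟨y, h1, h2⟩
    obtain ⟨h3, h4⟩ := (h.2.2 v y).1 h1
    exact ⟨h3, (hg y q h2).trans h4⟩
  · rintro ⟨hv, hq⟩
    obtain ⟨y, h1, h2⟩ := hg' q v hv hq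
    exact ⟨y, (h.2.2 v y).2 ⟨hv, h1⟩, h2⟩

theorem Describes.mul_gamma (h : Describes (x ++ y) α) (hg : g.graph = gammaGraph n (len x)) :
    Describes (rev x ++ y) (α * g) := by
  obtain ⟨h1, h2, -⟩ := id h
  rw [len_append] at h1
  refine h.mul (by rw [len_append, len_rev, h1]) (fun b hb => ?_) (fun y' q hq => ?_)
    fun q v hv hq => ?_
  · rcases List.mem_append.1 hb with hb | hb
    · simp only [rev, List.mem_reverse, List.mem_map] at hb
      obtain ⟨c, hc, rfl⟩ := hb
      simpa using h2 c (by simp [hc])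
    · exact h2 b (by simp [hb])
  · rw [hg] at hq
    obtain ⟨h3, h4, h5, h6⟩ := hq
    simp only at h3 h4 h5 h6
    split_ifs at h6
    · rw [getElem?_rev_append_left _ _ (by omega)]
      congr 1
      omega
    · rw [h6, getElem?_rev_append_right _ _ (by omega)]
  · have hqb := getElem?_len_lt hv hq
    rw [len_append, len_rev] at hqb
    have hqx : q ≠ len x := by
      rintro rfl
      rw [getElem?_rev_append_left _ _ le_rfl] at hq
      simp at hq
      omega
    rw [hg]
    simp only [gammaGraph, Set.mem_ofPred_eq]
    rcases Nat.lt_or_gt_of_ne hqx with hqx | hqx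
    · rw [getElem?_rev_append_left _ _ (by omega)] at hq
      exact ⟨_, hq, by omega, by omega, by omega, by rw [if_pos (by omega)]; omega⟩
    · rw [getElem?_rev_append_right _ _ (by omega)] at hq
      exact ⟨_, hq, by omega, by omega, by omega, by rw [if_neg (by omega)]⟩

theorem Describes.mul_delta (h : Describes (x ++ y) α) (hg : g.graph = deltaGraph n (len x)) :
    Describes (x ++ rev y) (α * g) := by
  obtain ⟨h1, h2, -⟩ := id h
  rw [len_append] at h1
  refine h.mul (by rw [len_append, len_rev, h1]) (fun b hb => ?_) (fun y' q hq => ?_)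
    fun q v hv hq => ?_
  · rcases List.mem_append.1 hb with hb | hb
    · exact h2 b (by simp [hb])
    · simp only [rev, List.mem_reverse, List.mem_map] at hb
      obtain ⟨c, hc, rfl⟩ := hb
      simpa using h2 c (by simp [hc])
  · rw [hg] at hq
    obtain ⟨h3, h4, h5, h6⟩ := hq
    simp only at h3 h4 h5 h6
    split_ifs at h6
    · rw [h6, getElem?_flat_append_left _ _ (by omega), getElem?_flat_append_left _ _ (by omega)]
    · rw [getElem?_append_rev_right _ _ (by omega) (by omega)]
      congr 1
      omega
  · have hqb := getElem?_len_lt hv hq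
    rw [len_append, len_rev] at hqb
    have hqx : q ≠ len x := by
      rintro rfl
      rw [getElem?_separator, Option.some_inj] at hq
      omega
    rw [hg]
    simp only [deltaGraph, Set.mem_ofPred_eq]
    rcases Nat.lt_or_gt_of_ne hqx with hqx | hqx
    · rw [getElem?_flat_append_left _ _ (by omega),
        ← getElem?_flat_append_left x y (by omega)] at hq
      exact ⟨_, hq, by omega, by omega, by omega, by rw [if_pos (by omega)]⟩
    · rw [getElem?_append_rev_right _ _ (by omega) (by omega)] at hq
      exact ⟨_, hq, by omega, by omega, by omega, by rw [if_neg (by omega)]; omega⟩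

theorem Describes.mul_sigma1 {a : ℕ} (h : Describes ([a] :: w) α)
    (hg : g.graph = sigma1Graph n) : Describes (w ++ [[a]]) (α * g) := by
  obtain ⟨h1, h2, -⟩ := id h
  have ha : len [[a]] = 2 := rfl
  rw [← List.singleton_append, len_append, ha] at h1
  refine h.mul (by rw [len_append, ha]; omega) (fun b hb => h2 b (by simp at hb ⊢; tauto))
    (fun y q hq => ?_) fun q v hv hq => ?_
  · rw [hg] at hq
    obtain ⟨h3, h4, h5, h6⟩ := hq
    simp only at h3 h4 h5 h6
    split_ifs at h6 with hy
    · rw [hy, h6, show n = len w + 1 by omega, getElem?_flat_append_right]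
      rfl
    · obtain ⟨k, rfl⟩ := Nat.exists_eq_add_of_le (show 2 ≤ y by omega)
      rw [h6, getElem?_flat_append_left _ _ (by omega), getElem?_singleton_cons]
      congr 1
      omega
  · have hqb := getElem?_len_lt hv hq
    rw [len_append, ha] at hqb
    rw [hg]
    simp only [sigma1Graph, Set.mem_ofPred_eq]
    by_cases hqw : q ≤ len w
    · rw [getElem?_flat_append_left _ _ hqw] at hq
      refine ⟨2 + q, ?_, by omega, ?_, by omega, by rw [if_neg (by omega)]; omega⟩
      · rw [getElem?_singleton_cons, hq]
      · have := getElem?_len_lt hv hq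
        omega
    · obtain rfl : q = len w + 1 := by omega
      rw [getElem?_flat_append_right] at hq
      exact ⟨1, hq, by omega, by omega, by omega, by rw [if_pos rfl]; omega⟩

theorem Describes.mul_sigma2 {a : ℕ} (h : Describes (w ++ [[a]]) α)
    (hg : g.graph = sigma2Graph n) : Describes ([a] :: w) (α * g) := by
  obtain ⟨h1, h2, -⟩ := id h
  have ha : len [[a]] = 2 := rfl
  rw [len_append, ha] at h1
  refine h.mul (by rw [← List.singleton_append, len_append, ha]; omega)
    (fun b hb => h2 b (by simp at hb ⊢; tauto)) (fun y q hq => ?_) fun q v hv hq => ?_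
  · rw [hg] at hq
    obtain ⟨h3, h4, h5, h6⟩ := hq
    simp only at h3 h4 h5 h6
    split_ifs at h6 with hy
    · rw [hy, h6, show n = len w + 1 by omega, getElem?_flat_append_right]
      rfl
    · rw [h6, getElem?_flat_append_left _ _ (by omega), add_comm y 2, getElem?_singleton_cons]
  · have hqb := getElem?_len_lt hv hq
    rw [← List.singleton_append, len_append, ha] at hqb
    rw [hg]
    simp only [sigma2Graph, Set.mem_ofPred_eq]
    by_cases hq1 : q = 1
    · subst hq1
      refine ⟨len w + 1, ?_, by omega, by omega, by omega, by rw [if_pos (by omega)]⟩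
      rw [getElem?_flat_append_right]
      exact hq
    · obtain ⟨k, rfl⟩ := Nat.exists_eq_add_of_le (show 2 ≤ q by omega)
      rw [getElem?_singleton_cons] at hq
      have := getElem?_len_lt hv hq
      refine ⟨k, ?_, by omega, by omega, by omega, by rw [if_neg (by omega)]; omega⟩
      rw [getElem?_flat_append_left _ _ (by omega), hq]

/-- Two words with the same letters are equivalent with respect to `G` if they describe elements of
the same right `G`-invariant sets. -/
def WordEquiv (G : Set (PartialInj n)) (w w' : List (List ℕ)) : Prop :=
  (flat w).Perm (flat w') ∧
    ∀ T : Set (PartialInj n), (∀ α ∈ T, ∀ g ∈ G, α * g ∈ T) → (Realized T w ↔ Realized T w')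

theorem WordEquiv.equivalence (G : Set (PartialInj n)) : Equivalence (WordEquiv G) :=
  ⟨fun _ => ⟨List.Perm.refl _, fun _ _ => Iff.rfl⟩,
    fun h => ⟨h.1.symm, fun T hT => (h.2 T hT).symm⟩,
    fun h h' => ⟨h.1.trans h'.1, fun T hT => (h.2 T hT).trans (h'.2 T hT)⟩⟩

theorem rev_eq_self {x : List (List ℕ)} (hx : len x ≤ 2) : rev x = x := by
  match x with
  | [] => rfl
  | [[]] => rfl
  | [[a]] => rfl
  | [] :: [] :: [] => rfl
  | (a :: b :: c) :: x => simp [len, flat] at hx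
  | [a] :: b :: x => simp [len, flat] at hx
  | [] :: (a :: b) :: x => simp [len, flat] at hx
  | [] :: [] :: b :: x => simp [len, flat] at hx

theorem exists_describes (α : PartialInj n) : ∃ w, Describes w α := by
  classical
  let f : ℕ → ℕ := fun y => if h : ∃ v, (v, y) ∈ α.graph then h.choose else 0
  have hf : ∀ v y, (v, y) ∈ α.graph ↔ v ≠ 0 ∧ f y = v := by
    intro v y
    constructor
    · intro h
      have hex : ∃ v, (v, y) ∈ α.graph := ⟨v, h⟩
      have hv := (α.mem_le _ h).1
      refine ⟨Nat.one_le_iff_ne_zero.1 hv, ?_⟩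
      simp only [f, dif_pos hex]
      exact α.injOn _ hex.choose_spec _ h rfl
    · rintro ⟨hv, rfl⟩
      by_cases hex : ∃ v, (v, y) ∈ α.graph
      · simp only [f, dif_pos hex]
        exact hex.choose_spec
      · simp [f, hex] at hv
  obtain ⟨w, hw, hw0⟩ := exists_flat_eq ((List.range n).map fun k => f (k + 1))
  refine ⟨w, by simp [len, hw], hw0, fun v y => ?_⟩
  rw [hf, hw]
  refine and_congr_right fun hv => ?_
  rcases y with _ | k
  · have : f 0 ≠ v := fun h => by
      have := (α.mem_le _ ((hf v 0).2 ⟨hv, h⟩)).2.2.1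
      simp at this
    simp [this, hv.symm]
  · rw [List.getElem?_cons_succ]
    by_cases hk : k < n
    · rw [List.getElem?_append_left (by simpa)]
      simp [hk]
    · have h1 : f (k + 1) ≠ v := fun h => by
        have := (α.mem_le _ ((hf v (k + 1)).2 ⟨hv, h⟩)).2.2.2
        simp only at this
        omega
      rw [List.getElem?_append_right (by simpa using hk)]
      simp only [h1, false_iff]
      intro h
      have := List.mem_of_getElem? h
      simp at this
      exact hv this

theorem Describes.mem_flat_iff (h : Describes w α) {v : ℕ} (hv : v ≠ 0) :
    v ∈ flat w ↔ v ∈ α.dom := by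
  constructor
  · intro hvw
    obtain ⟨q, hq⟩ := List.getElem?_of_mem (List.mem_cons_of_mem 0 hvw)
    exact ⟨q, (h.2.2 v q).2 ⟨hv, hq⟩⟩
  · rintro ⟨q, hq⟩
    have := List.mem_of_getElem? ((h.2.2 v q).1 hq).2
    simpa [hv] using this

theorem Describes.nodup_filter (h : Describes w α) : ((flat w).filter (· ≠ 0)).Nodup := by
  have h1 : (flat w).Pairwise fun a b => a ≠ 0 → a ≠ b := by
    rw [List.pairwise_iff_getElem]
    intro i j hi hj hij hi0 heq
    have hmem : ∀ k (hk : k < (flat w).length), (flat w)[k] = (flat w)[i] →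
        ((flat w)[i], k + 1) ∈ α.graph := fun k hk hki =>
      (h.2.2 _ _).2 ⟨hi0, by rw [List.getElem?_cons_succ, List.getElem?_eq_getElem hk, hki]⟩
    have := α.functional _ (hmem i hi rfl) _ (hmem j hj heq.symm) rfl
    simp only at this
    omega
  exact (h1.filter _).imp_of_mem fun ha _ hab => hab (by simpa using (List.mem_filter.1 ha).2)

theorem Describes.perm {β : PartialInj n} (h : Describes w α) (h' : Describes w' β)
    (hdom : α.dom = β.dom) : (flat w).Perm (flat w') := by
  have h1 : ((flat w).filter (· ≠ 0)).Perm ((flat w').filter (· ≠ 0)) := by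
    rw [List.perm_ext_iff_of_nodup h.nodup_filter h'.nodup_filter]
    intro v
    simp only [List.mem_filter, decide_eq_true_eq]
    refine and_congr_left fun hv => ?_
    rw [h.mem_flat_iff hv, h'.mem_flat_iff hv, hdom]
  have hz : ∀ l : List ℕ, l.filter (fun a => !decide (a ≠ 0)) = List.replicate
      (l.length - (l.filter (· ≠ 0)).length) 0 := by
    intro l
    refine List.eq_replicate_iff.2 ⟨?_, fun b hb => by simpa using (List.mem_filter.1 hb).2⟩
    have := (List.filter_append_perm (· ≠ 0) l).length_eq
    rw [List.length_append] at this
    omega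
  refine (List.filter_append_perm (· ≠ 0) _).symm.trans
    (List.Perm.trans ?_ (List.filter_append_perm (· ≠ 0) _))
  rw [hz, hz, h1.length_eq, show (flat w).length = (flat w').length from h.1.trans h'.1.symm]
  exact h1.append_right _

theorem Describes.eq {β : PartialInj n} (h : Describes w α) (h' : Describes w β) : α = β := by
  apply ext'
  ext ⟨v, y⟩
  rw [h.2.2, h'.2.2]

theorem mem_pid_graph {D : Set ℕ} {x y : ℕ} :
    (x, y) ∈ (pid n D).graph ↔ (1 ≤ x ∧ x ≤ n) ∧ x ∈ D ∧ y = x := Iff.rfl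

theorem mul_eq_pid {h : PartialInj n} {i : ℕ}
    (hgh : ∀ x y, (x, y) ∈ g.graph → x ≠ i ∧ (y, x) ∈ h.graph)
    (hdom : ∀ x, 1 ≤ x → x ≤ n → x ≠ i → x ∈ g.dom) : g * h = pid n {i}ᶜ := by
  apply ext'
  ext ⟨x, z⟩
  constructor
  · rintro ⟨y, h1, h2⟩
    obtain ⟨h3, h4⟩ := hgh x y h1
    exact ⟨⟨(g.mem_le _ h1).1, (g.mem_le _ h1).2.1⟩, h3, h.functional _ h2 _ h4 rfl⟩
  · rw [mem_pid_graph]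
    rintro ⟨⟨h1, h2⟩, h3, rfl⟩
    obtain ⟨y, hy⟩ := hdom _ h1 h2 h3
    exact ⟨y, hy, (hgh _ _ hy).2⟩

variable {σ₁ σ₂ : PartialInj n} {γ δ : ℕ → PartialInj n}

theorem wordMoves_wordEquiv (hn : Even n)
    (hσ₁ : σ₁.graph = sigma1Graph n) (hσ₂ : σ₂.graph = sigma2Graph n)
    (hγ : ∀ i, Even i → 4 ≤ i → i ≤ n → (γ i).graph = gammaGraph n i)
    (hδ : ∀ i, Odd i → i ≤ n - 3 → (δ i).graph = deltaGraph n i) :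
    WordMoves (n + 1) (WordEquiv (Gset n σ₁ σ₂ γ δ)) := by
  rw [Nat.even_iff] at hn
  refine ⟨WordEquiv.equivalence _, fun x y hlen hx => ?_, fun x y hlen hy => ?_,
    fun a w hlen => ?_⟩
  · by_cases hx2 : len x ≤ 2
    · rw [rev_eq_self hx2]
      exact (WordEquiv.equivalence _).refl _
    rw [len_append] at hlen
    rw [Nat.even_iff] at hx
    have hg := hγ (len x) (Nat.even_iff.2 hx) (by omega) (by omega)
    have hmem : γ (len x) ∈ Gset n σ₁ σ₂ γ δ :=
      Or.inl (Or.inr ⟨_, Nat.even_iff.2 hx, by omega, by omega, rfl⟩)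
    refine ⟨?_, fun T hT => ⟨?_, ?_⟩⟩
    · rw [flat_append, flat_append]
      exact (flat_rev_perm x).symm.append_right _
    · rintro ⟨α, hα, h⟩
      exact ⟨_, hT α hα _ hmem, h.mul_gamma hg⟩
    · rintro ⟨α, hα, h⟩
      have := h.mul_gamma (g := γ (len x)) (by rw [len_rev, hg])
      rw [rev_rev] at this
      exact ⟨_, hT α hα _ hmem, this⟩
  · by_cases hy2 : len y ≤ 2
    · rw [rev_eq_self hy2]
      exact (WordEquiv.equivalence _).refl _
    rw [len_append] at hlen
    rw [Nat.even_iff] at hy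
    have hodd : Odd (len x) := by rw [Nat.odd_iff]; omega
    have hg := hδ (len x) hodd (by omega)
    have hmem : δ (len x) ∈ Gset n σ₁ σ₂ γ δ := Or.inr ⟨_, hodd, by omega, rfl⟩
    refine ⟨?_, fun T hT => ⟨?_, ?_⟩⟩
    · rw [flat_append, flat_append]
      exact (flat_rev_perm y).symm.append_left _
    · rintro ⟨α, hα, h⟩
      exact ⟨_, hT α hα _ hmem, h.mul_delta hg⟩
    · rintro ⟨α, hα, h⟩
      have := h.mul_delta hg
      rw [rev_rev] at this
      exact ⟨_, hT α hα _ hmem, this⟩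
  · refine ⟨?_, fun T hT => ⟨?_, ?_⟩⟩
    · rw [← List.singleton_append, flat_append, flat_append]
      exact List.perm_append_comm
    · rintro ⟨α, hα, h⟩
      exact ⟨_, hT α hα σ₁ (by simp [Gset]), h.mul_sigma1 hσ₁⟩
    · rintro ⟨α, hα, h⟩
      exact ⟨_, hT α hα σ₂ (by simp [Gset]), h.mul_sigma2 hσ₂⟩

theorem Gset_subset_IFset (hn : Even n)
    (hσ₁ : σ₁.graph = sigma1Graph n) (hσ₂ : σ₂.graph = sigma2Graph n)
    (hγ : ∀ i, Even i → 4 ≤ i → i ≤ n → (γ i).graph = gammaGraph n i)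
    (hδ : ∀ i, Odd i → i ≤ n - 3 → (δ i).graph = deltaGraph n i) :
    Gset n σ₁ σ₂ γ δ ⊆ IFset n := by
  rintro g (((rfl | rfl | rfl) | ⟨i, h1, h2, h3, rfl⟩) | ⟨i, h1, h2, rfl⟩)
  · exact pid_mem_IFset _ _
  · exact sigma1_mem_IFset hn hσ₁
  · exact sigma2_mem_IFset hn hσ₂
  · exact gamma_mem_IFset h1 (hγ i h1 h2 h3)
  · exact delta_mem_IFset hn h1 (hδ i h1 h2)

theorem pid_compl_singleton_mem (hn : Even n)
    (hσ₁ : σ₁.graph = sigma1Graph n) (hσ₂ : σ₂.graph = sigma2Graph n)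
    (hγ : ∀ i, Even i → 4 ≤ i → i ≤ n → (γ i).graph = gammaGraph n i)
    (hδ : ∀ i, Odd i → i ≤ n - 3 → (δ i).graph = deltaGraph n i) {i : ℕ} (hi1 : 1 ≤ i)
    (hin : i ≤ n) : pid n {i}ᶜ ∈ Subsemigroup.closure (Gset n σ₁ σ₂ γ δ) := by
  rw [Nat.even_iff] at hn
  have hmul : ∀ g ∈ Gset n σ₁ σ₂ γ δ, ∀ h ∈ Gset n σ₁ σ₂ γ δ,
      g * h ∈ Subsemigroup.closure (Gset n σ₁ σ₂ γ δ) := fun g hg h hh =>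
    mul_mem (Subsemigroup.subset_closure hg) (Subsemigroup.subset_closure hh)
  have hS₁ : σ₁ ∈ Gset n σ₁ σ₂ γ δ := by simp [Gset]
  have hS₂ : σ₂ ∈ Gset n σ₁ σ₂ γ δ := by simp [Gset]
  rcases Nat.even_or_odd i with hi | hi
  · by_cases hi2 : i = 2
    · subst hi2
      rw [← mul_eq_pid (g := σ₁) (h := σ₂) (fun x y h => ?_) fun x h1 h2 h3 =>
        (mem_dom_of_graph (f := fun x => if x = 1 then n else x - 2) hσ₁ x).2 ⟨h1, h2, h3⟩]
      · exact hmul _ hS₁ _ hS₂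
      · rw [hσ₁] at h
        rw [hσ₂]
        simp only [sigma1Graph, sigma2Graph, Set.mem_ofPred_eq] at h ⊢
        split_ifs at h ⊢ <;> omega
    · have h4 : 4 ≤ i := by rw [Nat.even_iff] at hi; omega
      have hg := hγ i hi h4 hin
      rw [← mul_eq_pid (g := γ i) (h := γ i) (fun x y h => ?_) fun x h1 h2 h3 =>
        (mem_dom_of_graph (f := fun x => if x < i then i - x else x) hg x).2 ⟨h1, h2, h3⟩]
      · have hmem : γ i ∈ Gset n σ₁ σ₂ γ δ := Or.inl (Or.inr ⟨i, hi, h4, hin, rfl⟩)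
        exact hmul _ hmem _ hmem
      · rw [hg] at h ⊢
        simp only [gammaGraph, Set.mem_ofPred_eq] at h ⊢
        split_ifs at h ⊢ <;> omega
  · by_cases hin1 : i = n - 1
    · subst hin1
      rw [← mul_eq_pid (g := σ₂) (h := σ₁) (fun x y h => ?_) fun x h1 h2 h3 =>
        (mem_dom_of_graph (f := fun x => if x = n then 1 else x + 2) hσ₂ x).2 ⟨h1, h2, h3⟩]
      · exact hmul _ hS₂ _ hS₁
      · rw [hσ₂] at h
        rw [hσ₁]
        simp only [sigma1Graph, sigma2Graph, Set.mem_ofPred_eq] at h ⊢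
        split_ifs at h ⊢ <;> omega
    · have h3 : i ≤ n - 3 := by rw [Nat.odd_iff] at hi; omega
      have hg := hδ i hi h3
      rw [← mul_eq_pid (g := δ i) (h := δ i) (fun x y h => ?_) fun x h1 h2 h3 =>
        (mem_dom_of_graph (f := fun x => if x < i then x else n + i + 1 - x) hg x).2 ⟨h1, h2, h3⟩]
      · have hmem : δ i ∈ Gset n σ₁ σ₂ γ δ := Or.inr ⟨i, hi, h3, rfl⟩
        exact hmul _ hmem _ hmem
      · rw [hg] at h ⊢
        simp only [deltaGraph, Set.mem_ofPred_eq] at h ⊢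
        split_ifs at h ⊢ <;> omega

/-- A semigroup of partial injections which contains the identity and its restrictions to the
complements of single points contains all partial identities. -/
theorem pid_mem_of_singletons {S : Subsemigroup (PartialInj n)} (h1 : 1 ∈ S)
    (hS : ∀ i, 1 ≤ i → i ≤ n → pid n {i}ᶜ ∈ S) (D : Set ℕ) : pid n D ∈ S := by
  classical
  have key : ∀ F : Finset ℕ, F ⊆ Finset.Icc 1 n → pid n (↑F)ᶜ ∈ S := by
    intro F
    induction F using Finset.induction_on with
    | empty =>
      intro _
      convert h1 using 1
      apply ext'
      ext ⟨x, y⟩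
      exact ⟨fun h => ⟨h.1, h.1, h.2.2⟩, fun h => ⟨h.1, by simp, h.2.2⟩⟩
    | insert i F hi ih =>
      intro hF
      rw [Finset.insert_subset_iff, Finset.mem_Icc] at hF
      convert mul_mem (ih hF.2) (hS i hF.1.1 hF.1.2) using 1
      apply ext'
      ext ⟨x, y⟩
      constructor
      · rw [mem_pid_graph]
        rintro ⟨hx, hxF, rfl⟩
        simp only [Finset.coe_insert, Set.mem_compl_iff, Set.mem_insert_iff, not_or] at hxF
        exact ⟨_, ⟨hx, hxF.2, rfl⟩, hx, hxF.1, rfl⟩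
      · rintro ⟨z, h1, h2⟩
        rw [mem_pid_graph] at h1 h2 ⊢
        obtain ⟨hx, hxF, rfl⟩ := h1
        obtain ⟨-, hxi, hyz⟩ := h2
        refine ⟨hx, ?_, hyz⟩
        simp only [Finset.coe_insert, Set.mem_compl_iff, Set.mem_insert_iff, not_or]
        exact ⟨hxi, hxF⟩
  convert key ((Finset.Icc 1 n).filter (· ∉ D)) (Finset.filter_subset _ _) using 1
  apply ext'
  ext ⟨x, y⟩
  rw [mem_pid_graph, mem_pid_graph]
  refine and_congr_right fun hx => and_congr_left fun _ => ?_
  simp [hx]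

theorem dom_pid_dom (α : PartialInj n) : (pid n α.dom).dom = α.dom := by
  ext x
  constructor
  · rintro ⟨y, -, h, -⟩
    exact h
  · rintro ⟨y, h⟩
    exact ⟨x, ⟨(α.mem_le _ h).1, (α.mem_le _ h).2.1⟩, ⟨y, h⟩, rfl⟩

theorem closure_Gset (hn : Even n) (hn0 : 0 < n)
    (hσ₁ : σ₁.graph = sigma1Graph n) (hσ₂ : σ₂.graph = sigma2Graph n)
    (hγ : ∀ i, Even i → 4 ≤ i → i ≤ n → (γ i).graph = gammaGraph n i)
    (hδ : ∀ i, Odd i → i ≤ n - 3 → (δ i).graph = deltaGraph n i) :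
    (Subsemigroup.closure (Gset n σ₁ σ₂ γ δ) : Set (PartialInj n)) = IFset n := by
  have hG := Gset_subset_IFset hn hσ₁ hσ₂ hγ hδ
  apply Set.Subset.antisymm
  · exact (Subsemigroup.closure_le (S := ⟨IFset n, mul_mem_IFset⟩)).2 hG
  intro α hα
  have hpid : pid n α.dom ∈ Subsemigroup.closure (Gset n σ₁ σ₂ γ δ) :=
    pid_mem_of_singletons (Subsemigroup.subset_closure (Or.inl (Or.inl (Or.inl rfl))))
      (fun i h1 h2 => pid_compl_singleton_mem hn hσ₁ hσ₂ hγ hδ h1 h2) _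
  obtain ⟨u, hu⟩ := exists_describes (pid n α.dom)
  obtain ⟨v, hv⟩ := exists_describes α
  have huv : WordEquiv (Gset n σ₁ σ₂ γ δ) ([] ++ u) ([] ++ v) :=
    (wordMoves_wordEquiv hn hσ₁ hσ₂ hγ hδ).connected hn hn0
      (fun w w' hw => (hw.2 _ fun β hβ g hg => mul_mem_IFset hβ (hG hg)).1)
      (fun w w' hw => hw.1) u [] v ⟨_, pid_mem_IFset _ _, hu⟩ ⟨α, hα, hv⟩
      (hu.perm hv (dom_pid_dom α))
  obtain ⟨β, hβ, hβv⟩ := (huv.2 (Subsemigroup.closure (Gset n σ₁ σ₂ γ δ)) fun β hβ g hg =>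
    mul_mem hβ (Subsemigroup.subset_closure hg)).1 ⟨_, hpid, hu⟩
  rwa [hv.eq hβv]

end Generation

/-- Proposition 4: for even `n`, `G` is the least generating set of `IF_n`. -/
theorem prop4 (n : ℕ) (hn : Even n) (hn0 : 0 < n)
    (σ₁ σ₂ : PartialInj n) (γ δ : ℕ → PartialInj n)
    (hσ₁ : σ₁.graph = sigma1Graph n) (hσ₂ : σ₂.graph = sigma2Graph n)
    (hγ : ∀ i, Even i → 4 ≤ i → i ≤ n → (γ i).graph = gammaGraph n i)
    (hδ : ∀ i, Odd i → i ≤ n - 3 → (δ i).graph = deltaGraph n i) :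
    (↑(Subsemigroup.closure (Gset n σ₁ σ₂ γ δ)) = IFset n) ∧
    ∀ A : Set (PartialInj n), A ⊆ IFset n →
      ↑(Subsemigroup.closure A) = IFset n → Gset n σ₁ σ₂ γ δ ⊆ A := by
  have hG := closure_Gset hn hn0 hσ₁ hσ₂ hγ hδ
  refine ⟨hG, fun A _ hA g hg => mem_of_irreducible hA (Gset_subset_IFset hn hσ₁ hσ₂ hγ hδ hg)
    fun α hα β hβ h => ?_⟩
  rcases hg with ((rfl | rfl | rfl) | ⟨i, h1, h2, h3, rfl⟩) | ⟨i, h1, h2, rfl⟩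
  · exact Or.inl (one_irreducible hn hn0 hα h)
  · exact sigma1_irreducible hn hn0 hσ₁ hα hβ h
  · exact sigma2_irreducible hn hn0 hσ₂ hα hβ h
  · exact gamma_irreducible hn hn0 h1 h2 h3 (hγ i h1 h2 h3) hα hβ h
  · exact delta_irreducible hn hn0 h1 h2 (hδ i h1 h2) hα hβ h

end FencePaper
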